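/- Let Γ₀ ≤ SO(2,1)⁰ be a finitely generated Schottky group and let u : Γ₀ → ℝ³ be a cocycle. For a hyperbolic γ ∈ SO(2,1)⁰, let ℓ(γ) := log λ(γ), where λ(γ) > 1 is the largest eigenvalue of γ (so that the eigenvalues of γ are e^{ℓ(γ)}, 1, e^{−ℓ(γ)}; ℓ(γ) is the translation length of γ on the hyperbolic plane). Then there exists a constant C > 0 such that |α_u(γ)| ≤ C·ℓ(γ) for every nontrivial γ ∈ Γ₀. -/

import Mathlib

open Matrix

noncomputable section

/-- The Lorentzian bilinear form on `ℝ³`: `B(v,w) = v₁w₁ + v₂w₂ − v₃w₃`. -/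
def Bform (v w : Fin 3 → ℝ) : ℝ := v 0 * w 0 + v 1 * w 1 - v 2 * w 2

/-- `SO(2,1)⁰`: linear automorphisms of `ℝ³` preserving `B`, with determinant 1,
preserving the future cone `{v | B(v,v) < 0, v₃ > 0}`. -/
def SO21 (γ : Matrix (Fin 3) (Fin 3) ℝ) : Prop :=
  (∀ v w : Fin 3 → ℝ, Bform (γ.mulVec v) (γ.mulVec w) = Bform v w) ∧
  γ.det = 1 ∧
  (∀ v : Fin 3 → ℝ, Bform v v < 0 → 0 < v 2 → 0 < γ.mulVec v 2)

/-- A matrix is hyperbolic if it has an eigenvalue `λ > 1`. -/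
def IsHyperbolic (γ : Matrix (Fin 3) (Fin 3) ℝ) : Prop :=
  ∃ lam : ℝ, 1 < lam ∧ ∃ v : Fin 3 → ℝ, v ≠ 0 ∧ γ.mulVec v = lam • v

/-- `x0` is the neutral vector of `γ`: fixed by `γ`, of unit `B`-norm, and such that
`det(x₋, x⁰, x₊) > 0` for (any) future-pointing eigenvectors `x₋, x₊` of `γ` for the
eigenvalues `λ > 1` and `λ⁻¹`. -/
def IsNeutral (γ : Matrix (Fin 3) (Fin 3) ℝ) (x0 : Fin 3 → ℝ) : Prop :=
  γ.mulVec x0 = x0 ∧ Bform x0 x0 = 1 ∧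
  (∀ (lam : ℝ) (xm xp : Fin 3 → ℝ), 1 < lam → xm ≠ 0 → xp ≠ 0 →
    γ.mulVec xm = lam • xm → γ.mulVec xp = lam⁻¹ • xp →
    0 < xm 2 → 0 < xp 2 → 0 < (Matrix.of ![xm, x0, xp]).det)

/-- The underlying matrix of an element of a subgroup of `GL(3,ℝ)`. -/
def toM {Γ₀ : Subgroup (Matrix (Fin 3) (Fin 3) ℝ)ˣ} (γ : Γ₀) : Matrix (Fin 3) (Fin 3) ℝ :=
  ((γ : (Matrix (Fin 3) (Fin 3) ℝ)ˣ) : Matrix (Fin 3) (Fin 3) ℝ)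

/-- A Schottky group: a nonabelian discrete subgroup of `SO(2,1)⁰` all of whose
nontrivial elements are hyperbolic. -/
def IsSchottky (Γ₀ : Subgroup (Matrix (Fin 3) (Fin 3) ℝ)ˣ) : Prop :=
  (∀ γ : Γ₀, SO21 (toM γ)) ∧
  DiscreteTopology Γ₀ ∧
  (∃ a b : Γ₀, a * b ≠ b * a) ∧
  (∀ γ : Γ₀, γ ≠ 1 → IsHyperbolic (toM γ))

/-- A cocycle `u : Γ₀ → ℝ³`, i.e. `u(γ₁γ₂) = u(γ₁) + γ₁ u(γ₂)`. -/
def IsCocycle (Γ₀ : Subgroup (Matrix (Fin 3) (Fin 3) ℝ)ˣ) (u : Γ₀ → Fin 3 → ℝ) : Prop :=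
  ∀ γ₁ γ₂ : Γ₀, u (γ₁ * γ₂) = u γ₁ + (toM γ₁).mulVec (u γ₂)

/-- The affine deformation `γ·x = γx + u(γ)` acts properly discontinuously on `ℝ³`. -/
def ProperlyDisc (Γ₀ : Subgroup (Matrix (Fin 3) (Fin 3) ℝ)ˣ) (u : Γ₀ → Fin 3 → ℝ) : Prop :=
  ∀ K : Set (Fin 3 → ℝ), IsCompact K →
    {γ : Γ₀ | ∃ x ∈ K, (toM γ).mulVec x + u γ ∈ K}.Finite

/-! ### Basic algebra of the form -/

lemma B_comm (v w : Fin 3 → ℝ) : Bform v w = Bform w v := by simp [Bform]; ring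
lemma B_add_l (a b c : Fin 3 → ℝ) : Bform (a + b) c = Bform a c + Bform b c := by
  simp [Bform]; ring
lemma B_add_r (a b c : Fin 3 → ℝ) : Bform a (b + c) = Bform a b + Bform a c := by
  simp [Bform]; ring
lemma B_sub_l (a b c : Fin 3 → ℝ) : Bform (a - b) c = Bform a c - Bform b c := by
  simp [Bform]; ring
lemma B_sub_r (a b c : Fin 3 → ℝ) : Bform a (b - c) = Bform a b - Bform a c := by
  simp [Bform]; ring
lemma B_smul_l (r : ℝ) (b c : Fin 3 → ℝ) : Bform (r • b) c = r * Bform b c := by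
  simp [Bform]; ring
lemma B_smul_r (r : ℝ) (b c : Fin 3 → ℝ) : Bform b (r • c) = r * Bform b c := by
  simp [Bform]; ring

/-- base point -/
def oo : Fin 3 → ℝ := ![0, 0, 1]

lemma B_oo (v : Fin 3 → ℝ) : Bform v oo = - v 2 := by simp [Bform, oo]
lemma oo_two : oo 2 = 1 := by simp [oo]

/-- closed future cone -/
def Fut (v : Fin 3 → ℝ) : Prop := Bform v v ≤ 0 ∧ 0 ≤ v 2

lemma sq_of_fut {v : Fin 3 → ℝ} (h : Fut v) : Real.sqrt (v 0 ^ 2 + v 1 ^ 2) ≤ v 2 := by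
  rw [Real.sqrt_le_left h.2]
  have := h.1
  simp only [Bform] at this
  nlinarith

lemma cs2 (x w : Fin 3 → ℝ) :
    x 0 * w 0 + x 1 * w 1 ≤ Real.sqrt (x 0 ^ 2 + x 1 ^ 2) * Real.sqrt (w 0 ^ 2 + w 1 ^ 2) := by
  rw [← Real.sqrt_mul (by positivity)]
  apply Real.le_sqrt_of_sq_le
  nlinarith [sq_nonneg (x 0 * w 1 - x 1 * w 0)]

/-- crude triangle inequality -/
lemma crude {x w : Fin 3 → ℝ} (hx : Fut x) (hw : Fut w) :
    (- Bform x x) * w 2 ≤ 2 * x 2 * (- Bform x w) := by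
  have h1 := sq_of_fut hx
  have h2 := sq_of_fut hw
  have h3 := cs2 x w
  set r := Real.sqrt (x 0 ^ 2 + x 1 ^ 2) with hr
  set s := Real.sqrt (w 0 ^ 2 + w 1 ^ 2) with hs
  have hr0 : 0 ≤ r := Real.sqrt_nonneg _
  have hr2 : r ^ 2 = x 0 ^ 2 + x 1 ^ 2 := Real.sq_sqrt (by positivity)
  have h4 : (x 2 - r) * w 2 ≤ - Bform x w := by
    simp only [Bform]
    nlinarith [mul_le_mul_of_nonneg_left h2 hr0]
  have h5 : - Bform x x = (x 2 - r) * (x 2 + r) := by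
    simp only [Bform]; nlinarith
  rw [h5]
  have h6 : 0 ≤ (x 2 - r) * w 2 := mul_nonneg (by linarith) hw.2
  nlinarith [hx.2, mul_le_mul_of_nonneg_left h4 (mul_nonneg zero_le_two hx.2), mul_le_mul_of_nonneg_left h1 h6]

lemma fut_pair {x w : Fin 3 → ℝ} (hx : Fut x) (hw : Fut w) : Bform x w ≤ 0 := by
  have h1 := sq_of_fut hx
  have h2 := sq_of_fut hw
  have h3 := cs2 x w
  have := mul_le_mul h1 h2 (Real.sqrt_nonneg _) hx.2
  simp only [Bform]
  linarith

lemma fut_add {x w : Fin 3 → ℝ} (hx : Fut x) (hw : Fut w) : Fut (x + w) := by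
  refine ⟨?_, add_nonneg hx.2 hw.2⟩
  simp only [B_add_l, B_add_r]
  have := fut_pair hx hw
  have := fut_pair hw hx
  linarith [hx.1, hw.1]

lemma fut_smul {x : Fin 3 → ℝ} (hx : Fut x) {t : ℝ} (ht : 0 ≤ t) : Fut (t • x) := by
  refine ⟨?_, by simpa using mul_nonneg ht hx.2⟩
  simp only [B_smul_l, B_smul_r]
  nlinarith [hx.1, mul_nonneg ht ht]

lemma fut_q {x w : Fin 3 → ℝ} (hx : Fut x) (hw : Fut w) :
    - Bform x x ≤ - Bform (x + w) (x + w) := by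
  simp only [B_add_l, B_add_r]
  have := fut_pair hx hw
  have := fut_pair hw hx
  linarith [hx.1, hw.1]

lemma pair_neg {x w : Fin 3 → ℝ} (hx : Bform x x < 0) (hx2 : 0 < x 2) (hw : Fut w)
    (hw2 : 0 < w 2) : Bform x w < 0 := by
  have h := crude ⟨hx.le, hx2.le⟩ hw
  have : 0 < (- Bform x x) * w 2 := mul_pos (by linarith) hw2
  by_contra hc
  push Not at hc
  nlinarith

lemma cs_rev {x w : Fin 3 → ℝ} (hx : Bform x x = -1) (hx2 : 0 < x 2) (hw : Bform w w = -1)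
    (hw2 : 0 < w 2) : Bform x w ≤ -1 := by
  have h0 := fut_pair (x := x) (w := w) ⟨by linarith, hx2.le⟩ ⟨by linarith, hw2.le⟩
  have h3 : 1 ≤ (Bform x w) ^ 2 := by
    have h1 := sq_of_fut (v := x) ⟨by linarith, hx2.le⟩
    have h2 := sq_of_fut (v := w) ⟨by linarith, hw2.le⟩
    have h3 := cs2 x w
    set r := Real.sqrt (x 0 ^ 2 + x 1 ^ 2) with hr
    set s := Real.sqrt (w 0 ^ 2 + w 1 ^ 2) with hs
    have hr0 : 0 ≤ r := Real.sqrt_nonneg _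
    have hs0 : 0 ≤ s := Real.sqrt_nonneg _
    have hr2 : r ^ 2 = x 0 ^ 2 + x 1 ^ 2 := Real.sq_sqrt (by positivity)
    have hs2 : s ^ 2 = w 0 ^ 2 + w 1 ^ 2 := Real.sq_sqrt (by positivity)
    simp only [Bform] at hx hw ⊢
    have a1 : x 2 ^ 2 = 1 + r ^ 2 := by linarith
    have a2 : w 2 ^ 2 = 1 + s ^ 2 := by linarith
    have a3 : 1 + r * s ≤ x 2 * w 2 := by
      refine (pow_le_pow_iff_left₀ (by positivity) (by positivity) two_ne_zero).1 ?_
      have : (x 2 * w 2) ^ 2 = (1 + r ^ 2) * (1 + s ^ 2) := by rw [mul_pow, a1, a2]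
      rw [this]; nlinarith [sq_nonneg (r - s)]
    nlinarith
  nlinarith

lemma light_prop {x w : Fin 3 → ℝ} (hx : Bform x x = 0) (hw : Bform w w = 0)
    (hxw : Bform x w = 0) : (w 2) • x = (x 2) • w := by
  simp only [Bform] at hx hw hxw
  have key : (w 2 * x 0 - x 2 * w 0) ^ 2 + (w 2 * x 1 - x 2 * w 1) ^ 2 = 0 := by
    have e1 : x 0 ^ 2 + x 1 ^ 2 = x 2 ^ 2 := by linarith
    have e2 : w 0 ^ 2 + w 1 ^ 2 = w 2 ^ 2 := by linarith
    have e3 : x 0 * w 0 + x 1 * w 1 = x 2 * w 2 := by linarith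
    calc _ = w 2 ^ 2 * (x 0 ^ 2 + x 1 ^ 2) + x 2 ^ 2 * (w 0 ^ 2 + w 1 ^ 2)
        - 2 * (w 2 * x 2) * (x 0 * w 0 + x 1 * w 1) := by ring
      _ = 0 := by rw [e1, e2, e3]; ring
  have k0 : w 2 * x 0 - x 2 * w 0 = 0 := by nlinarith [sq_nonneg (w 2 * x 0 - x 2 * w 0), sq_nonneg (w 2 * x 1 - x 2 * w 1)]
  have k1 : w 2 * x 1 - x 2 * w 1 = 0 := by nlinarith [sq_nonneg (w 2 * x 0 - x 2 * w 0), sq_nonneg (w 2 * x 1 - x 2 * w 1)]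
  ext i
  fin_cases i
  · simp; linarith
  · simp; linarith
  · simp; ring

lemma light_pair_neg {x w : Fin 3 → ℝ} (hx : Bform x x = 0) (hw : Bform w w = 0)
    (hx2 : 0 < x 2) (hw2 : 0 < w 2) (hne : ∀ c : ℝ, x ≠ c • w) : Bform x w < 0 := by
  rcases lt_or_eq_of_le (fut_pair ⟨hx.le, hx2.le⟩ ⟨hw.le, hw2.le⟩) with h | h
  · exact h
  · exfalso
    have := light_prop hx hw h
    apply hne ((w 2)⁻¹ * x 2)
    rw [mul_smul, ← this, smul_smul, inv_mul_cancel₀ hw2.ne', one_smul]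

/-- coordinate bound -/
lemma coord_bound {v : Fin 3 → ℝ} {R : ℝ} (hv : Bform v v ≤ 1) (hR : |v 2| ≤ R) (i : Fin 3) :
    |v i| ≤ 1 + R := by
  have hR0 : 0 ≤ R := (abs_nonneg _).trans hR
  have h2 : v 2 ^ 2 ≤ R ^ 2 := sq_le_sq' (by linarith [(abs_le.1 hR).1]) (abs_le.1 hR).2
  simp only [Bform] at hv
  fin_cases i
  · apply abs_le_of_sq_le_sq _ (by linarith); simp; nlinarith [sq_nonneg (v 1)]
  · apply abs_le_of_sq_le_sq _ (by linarith); simp; nlinarith [sq_nonneg (v 0)]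
  · simp; linarith

/-- nondegeneracy -/
lemma nondeg {a b c n : Fin 3 → ℝ}
    (hG : (!![Bform a a, Bform a b, Bform a c; Bform b a, Bform b b, Bform b c;
      Bform c a, Bform c b, Bform c c]).det ≠ 0)
    (ha : Bform n a = 0) (hb : Bform n b = 0) (hc : Bform n c = 0) : n = 0 := by
  have hP : (!![a 0, a 1, -a 2; b 0, b 1, - b 2; c 0, c 1, - c 2]).det ≠ 0 := by
    intro h0
    apply hG
    have : (!![Bform a a, Bform a b, Bform a c; Bform b a, Bform b b, Bform b c;
      Bform c a, Bform c b, Bform c c]).det =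
      - (!![a 0, a 1, -a 2; b 0, b 1, - b 2; c 0, c 1, - c 2]).det ^ 2 := by
      simp only [Matrix.det_fin_three, Bform]
      simp
      ring
    rw [this, h0]; simp
  apply Matrix.eq_zero_of_mulVec_eq_zero hP
  ext i
  fin_cases i
  · simp [Matrix.mulVec, dotProduct, Fin.sum_univ_three]; simp [Bform] at ha; linarith
  · simp [Matrix.mulVec, dotProduct, Fin.sum_univ_three]; simp [Bform] at hb; linarith
  · simp [Matrix.mulVec, dotProduct, Fin.sum_univ_three]; simp [Bform] at hc; linarith

/-! ### Group action -/

section act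
variable {Γ₀ : Subgroup (Matrix (Fin 3) (Fin 3) ℝ)ˣ}

/-- action -/
def act (g : Γ₀) (v : Fin 3 → ℝ) : Fin 3 → ℝ := (toM g).mulVec v

lemma act_mul (g h : Γ₀) (v : Fin 3 → ℝ) : act (g * h) v = act g (act h v) := by
  simp [act, toM]
lemma act_one (v : Fin 3 → ℝ) : act (1 : Γ₀) v = v := by simp [act, toM]
lemma act_inv_act (g : Γ₀) (v : Fin 3 → ℝ) : act g⁻¹ (act g v) = v := by
  rw [← act_mul, inv_mul_cancel, act_one]
lemma act_act_inv (g : Γ₀) (v : Fin 3 → ℝ) : act g (act g⁻¹ v) = v := by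
  rw [← act_mul, mul_inv_cancel, act_one]
lemma act_add (g : Γ₀) (v w : Fin 3 → ℝ) : act g (v + w) = act g v + act g w := by
  simp [act, Matrix.mulVec_add]
lemma act_smul (g : Γ₀) (r : ℝ) (v : Fin 3 → ℝ) : act g (r • v) = r • act g v := by
  simp [act, Matrix.mulVec_smul]

/-- orbit point -/
def orb (g : Γ₀) : Fin 3 → ℝ := act g oo

lemma orb_mul (g h : Γ₀) : orb (g * h) = act g (orb h) := act_mul _ _ _

lemma B_act (h : ∀ γ : Γ₀, SO21 (toM γ)) (g : Γ₀) (v w : Fin 3 → ℝ) :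
    Bform (act g v) (act g w) = Bform v w := (h g).1 v w

lemma B_act_l (h : ∀ γ : Γ₀, SO21 (toM γ)) (g : Γ₀) (v w : Fin 3 → ℝ) :
    Bform (act g v) w = Bform v (act g⁻¹ w) := by
  rw [← B_act h g v, act_act_inv]

lemma act_inv_two (h : ∀ γ : Γ₀, SO21 (toM γ)) (g : Γ₀) (v : Fin 3 → ℝ) :
    act g⁻¹ v 2 = - Bform v (orb g) := by
  have := B_act_l h g⁻¹ v oo
  rw [B_oo, inv_inv] at this
  unfold orb; linarith

lemma act_two_pos (h : ∀ γ : Γ₀, SO21 (toM γ)) (g : Γ₀) {v : Fin 3 → ℝ}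
    (hv : Bform v v < 0) (h2 : 0 < v 2) : 0 < act g v 2 := (h g).2.2 v hv h2

lemma orb_B (h : ∀ γ : Γ₀, SO21 (toM γ)) (g : Γ₀) : Bform (orb g) (orb g) = -1 := by
  rw [orb, B_act h]; simp [Bform, oo]

lemma orb_two (h : ∀ γ : Γ₀, SO21 (toM γ)) (g : Γ₀) : 0 < orb g 2 :=
  act_two_pos h g (by simp [Bform, oo]) (by simp [oo])

lemma orb_fut (h : ∀ γ : Γ₀, SO21 (toM γ)) (g : Γ₀) : Fut (orb g) :=
  ⟨by rw [orb_B h]; norm_num, (orb_two h g).le⟩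

lemma crude_orb (h : ∀ γ : Γ₀, SO21 (toM γ)) (g : Γ₀) {x w : Fin 3 → ℝ}
    (hx : Bform x x < 0) (hx2 : 0 < x 2) (hw : Bform w w ≤ 0) (hw2 : Bform w (orb g) ≤ 0) :
    (- Bform x x) * (- Bform w (orb g)) ≤ 2 * (- Bform x (orb g)) * (- Bform x w) := by
  have h1 : Fut (act g⁻¹ x) := ⟨by rw [B_act h]; exact hx.le, (act_two_pos h _ hx hx2).le⟩
  have h2 : Fut (act g⁻¹ w) := ⟨by rw [B_act h]; exact hw, by rw [act_inv_two h]; linarith⟩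
  have := crude h1 h2
  rwa [B_act h, B_act h, act_inv_two h, act_inv_two h] at this

/-- the closed convex cone spanned by the orbit, via duality -/
def InC (Γ₀ : Subgroup (Matrix (Fin 3) (Fin 3) ℝ)ˣ) (v : Fin 3 → ℝ) : Prop :=
  ∀ f : Fin 3 → ℝ, (∀ g : Γ₀, 0 ≤ Bform f (orb g)) → 0 ≤ Bform f v

lemma InC_act (h : ∀ γ : Γ₀, SO21 (toM γ)) (g : Γ₀) {v : Fin 3 → ℝ} (hv : InC Γ₀ v) :
    InC Γ₀ (act g v) := by
  intro f hf
  rw [B_comm, B_act_l h, B_comm]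
  apply hv
  intro k
  rw [B_act_l h, inv_inv, ← orb_mul]
  exact hf _

/-- the ray from `z` towards `ζ` stays far away from the orbit -/
def RayFree (Γ₀ : Subgroup (Matrix (Fin 3) (Fin 3) ℝ)ˣ) (M : ℝ) (z ζ : Fin 3 → ℝ) : Prop :=
  ∀ t : ℝ, 0 ≤ t → ∀ g : Γ₀,
    M * (- Bform (z + t • ζ) (z + t • ζ)) < (Bform (z + t • ζ) (orb g)) ^ 2

lemma RayFree.scale {M : ℝ} {z ζ : Fin 3 → ℝ} (H : RayFree Γ₀ M z ζ) {w b : ℝ} (hw : 0 < w)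
    (hb : 0 ≤ b) (g : Γ₀) :
    M * (- Bform (w • z + b • ζ) (w • z + b • ζ)) < (Bform (w • z + b • ζ) (orb g)) ^ 2 := by
  have := H (b / w) (by positivity) g
  have e : w • z + b • ζ = w • (z + (b / w) • ζ) := by
    rw [smul_add, smul_smul]; congr 2; field_simp
  rw [e, B_smul_l, B_smul_l, B_smul_r]
  have hw2 : 0 < w ^ 2 := by positivity
  nlinarith [mul_lt_mul_of_pos_left this hw2]

/-- sector lemma -/
lemma sector (h : ∀ γ : Γ₀, SO21 (toM γ)) {S : Set Γ₀} (hS : Subgroup.closure S = ⊤) {L : ℝ}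
    (hL1 : 1 ≤ L) (hL : ∀ s ∈ S, orb s 2 ≤ L) {z ζ ζ' A C W : Fin 3 → ℝ}
    (hz : Bform z z < 0) (hz2 : 0 < z 2) (hζ : Bform ζ ζ = 0) (hζ2 : 0 < ζ 2)
    (hζ' : Bform ζ' ζ' = 0) (hζ2' : 0 < ζ' 2)
    (hexp : ∀ x, x = Bform W x • z + Bform A x • ζ + Bform C x • ζ')
    (hr : RayFree Γ₀ (L ^ 2) z ζ) (hr' : RayFree Γ₀ (L ^ 2) z ζ') :
    (∀ g : Γ₀, 0 < Bform A (orb g) ∧ 0 < Bform C (orb g)) ∨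
    (∀ g : Γ₀, ¬ (0 < Bform A (orb g) ∧ 0 < Bform C (orb g))) := by
  have hzζ := pair_neg hz hz2 ⟨hζ.le, hζ2.le⟩ hζ2
  have hzζ' := pair_neg hz hz2 ⟨hζ'.le, hζ2'.le⟩ hζ2'
  -- a segment from inside to outside is impossible
  have key : ∀ g k : Γ₀, - Bform (orb g) (orb k) ≤ L →
      (0 < Bform A (orb g) ∧ 0 < Bform C (orb g)) →
      (0 < Bform A (orb k) ∧ 0 < Bform C (orb k)) := by
    intro g k hgk hg
    by_contra hk
    have hk' : min (Bform A (orb k)) (Bform C (orb k)) ≤ 0 := by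
      by_contra hc; push Not at hc; exact hk (lt_min_iff.1 hc)
    have hg' : 0 ≤ min (Bform A (orb g)) (Bform C (orb g)) := (lt_min hg.1 hg.2).le
    let F : ℝ → ℝ := fun t => min ((1 - t) * Bform A (orb g) + t * Bform A (orb k))
      ((1 - t) * Bform C (orb g) + t * Bform C (orb k))
    have hF : ContinuousOn F (Set.Icc 0 1) := by fun_prop
    have hm := intermediate_value_Icc' (zero_le_one) hF
    have h0 : (0 : ℝ) ∈ Set.Icc (F 1) (F 0) := by
      constructor
      · simpa [F] using hk'
      · simpa [F] using hg'
    obtain ⟨t, ⟨ht0, ht1⟩, ht⟩ := hm h0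
    set y := (1 - t) • orb g + t • orb k with hy
    have hyA : Bform A y = (1 - t) * Bform A (orb g) + t * Bform A (orb k) := by
      rw [hy, B_add_r, B_smul_r, B_smul_r]
    have hyC : Bform C y = (1 - t) * Bform C (orb g) + t * Bform C (orb k) := by
      rw [hy, B_add_r, B_smul_r, B_smul_r]
    have hmin : min (Bform A y) (Bform C y) = 0 := by rw [hyA, hyC]; exact ht
    have hgk1 : Bform (orb g) (orb k) ≤ -1 := by
      exact cs_rev (orb_B h g) (orb_two h g) (orb_B h k) (orb_two h k)
    have hyy : 1 ≤ - Bform y y := by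
      rw [hy]; simp only [B_add_l, B_add_r, B_smul_l, B_smul_r, orb_B h, B_comm (orb k) (orb g)]
      nlinarith [mul_nonneg ht0 (sub_nonneg.2 ht1)]
    have hyF : Fut y := fut_add (fut_smul (orb_fut h g) (by linarith)) (fut_smul (orb_fut h k) ht0)
    have hy2 : 0 < y 2 := by
      rcases hyF.2.lt_or_eq with h | h
      · exact h
      · exfalso; simp only [Bform] at hyy; rw [← h] at hyy; nlinarith [sq_nonneg (y 0), sq_nonneg (y 1)]
    have hyneg : Bform y y < 0 := by linarith
    have hyζ := pair_neg hyneg hy2 ⟨hζ.le, hζ2.le⟩ hζ2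
    have hyζ' := pair_neg hyneg hy2 ⟨hζ'.le, hζ2'.le⟩ hζ2'
    have hyg : (Bform y (orb g)) ^ 2 ≤ L ^ 2 * (- Bform y y) := by
      have : |Bform y (orb g)| ≤ L := by
        rw [abs_le]
        rw [hy, B_add_l, B_smul_l, B_smul_l, orb_B h, B_comm (orb k) (orb g)]
        constructor <;> nlinarith
      have := sq_le_sq' (by linarith [(abs_le.1 this).1]) (abs_le.1 this).2
      nlinarith [sq_nonneg L]
    have he := hexp y
    rcases le_total (Bform A y) (Bform C y) with hAC | hAC
    · rw [min_eq_left hAC] at hmin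
      rw [hmin, zero_smul, add_zero] at he
      have hw : 0 < Bform W y := by
        have e := congrArg (fun v => Bform v ζ') he
        simp only [B_add_l, B_smul_l, hζ'] at e
        by_contra hc; push Not at hc; nlinarith
      have := hr'.scale hw (hmin ▸ hAC) g
      rw [← he] at this
      linarith
    · rw [min_eq_right hAC] at hmin
      rw [hmin, zero_smul, add_zero] at he
      have hw : 0 < Bform W y := by
        have e := congrArg (fun v => Bform v ζ) he
        simp only [B_add_l, B_smul_l, hζ] at e
        by_contra hc; push Not at hc; nlinarith
      have := hr.scale hw (hmin ▸ hAC) g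
      rw [← he] at this
      linarith
  have step : ∀ g s : Γ₀, s ∈ S → ((0 < Bform A (orb g) ∧ 0 < Bform C (orb g)) ↔
      (0 < Bform A (orb (g * s)) ∧ 0 < Bform C (orb (g * s)))) := by
    intro g s hs
    have e : - Bform (orb g) (orb (g * s)) ≤ L := by
      rw [orb_mul, orb, B_act h, B_comm, B_oo, neg_neg]; exact hL s hs
    exact ⟨key _ _ e, key _ _ (by rw [B_comm]; exact e)⟩
  have all : ∀ g : Γ₀, ((0 < Bform A (orb g) ∧ 0 < Bform C (orb g)) ↔
      (0 < Bform A (orb (1 : Γ₀)) ∧ 0 < Bform C (orb (1 : Γ₀)))) := by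
    intro g
    have hg : g ∈ Subgroup.closure S := by rw [hS]; trivial
    induction hg using Subgroup.closure_induction_right with
    | one => rfl
    | mul_right x hx y hy ih => rw [← step x y hy]; exact ih
    | mul_inv_cancel x hx y hy ih =>
      rw [step _ y hy]; simpa using ih
  by_cases h1 : 0 < Bform A (orb (1 : Γ₀)) ∧ 0 < Bform C (orb (1 : Γ₀))
  · left; intro g; exact (all g).2 h1
  · right; intro g hg; exact h1 ((all g).1 hg)

end act

set_option linter.unusedSimpArgs false
section tri
variable {Γ₀ : Subgroup (Matrix (Fin 3) (Fin 3) ℝ)ˣ}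

/-- three free rays, core -/
lemma three_rays_core (h : ∀ γ : Γ₀, SO21 (toM γ)) {S : Set Γ₀} (hS : Subgroup.closure S = ⊤)
    {L : ℝ} (hL1 : 1 ≤ L) (hL : ∀ s ∈ S, orb s 2 ≤ L) {z ζ1 ζ2 ζ3 f1 f2 f3 : Fin 3 → ℝ}
    (hz : Bform z z < 0) (hz2 : 0 < z 2)
    (l1 : Bform ζ1 ζ1 = 0) (t1 : 0 < ζ1 2) (l2 : Bform ζ2 ζ2 = 0) (t2 : 0 < ζ2 2)
    (l3 : Bform ζ3 ζ3 = 0) (t3 : 0 < ζ3 2)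
    (n13 : Bform ζ1 ζ3 < 0) (n23 : Bform ζ2 ζ3 < 0)
    (c1 : InC Γ₀ ζ1) (c2 : InC Γ₀ ζ2) (c3 : InC Γ₀ ζ3)
    (r1 : RayFree Γ₀ (L ^ 2) z ζ1) (r2 : RayFree Γ₀ (L ^ 2) z ζ2) (r3 : RayFree Γ₀ (L ^ 2) z ζ3)
    (hexp : ∀ x, x = Bform f1 x • ζ1 + Bform f2 x • ζ2 + Bform f3 x • ζ3)
    (d11 : Bform f1 ζ1 = 1) (d12 : Bform f1 ζ2 = 0) (d13 : Bform f1 ζ3 = 0)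
    (d21 : Bform f2 ζ1 = 0) (d22 : Bform f2 ζ2 = 1) (d23 : Bform f2 ζ3 = 0)
    (d33 : Bform f3 ζ3 = 1)
    (p1 : 0 < Bform f1 z) (p2 : 0 < Bform f2 z) : False := by
  set a := Bform f1 z with ha
  set b := Bform f2 z with hb
  set c := Bform f3 z with hc
  have hez : z = a • ζ1 + b • ζ2 + c • ζ3 := hexp z
  have hzζ1 := pair_neg hz hz2 ⟨l1.le, t1.le⟩ t1
  have hzζ2 := pair_neg hz hz2 ⟨l2.le, t2.le⟩ t2
  have hzζ3 := pair_neg hz hz2 ⟨l3.le, t3.le⟩ t3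
  -- expansions
  have e13 : ∀ x, x = Bform (b⁻¹ • f2) x • z + Bform (f1 - (a * b⁻¹) • f2) x • ζ1
      + Bform (f3 - (c * b⁻¹) • f2) x • ζ3 := by
    intro x
    conv_lhs => rw [hexp x]
    conv_rhs => rw [hez]
    simp only [B_sub_l, B_smul_l]
    ext i
    simp
    field_simp
    ring
  have e23 : ∀ x, x = Bform (a⁻¹ • f1) x • z + Bform (f2 - (b * a⁻¹) • f1) x • ζ2
      + Bform (f3 - (c * a⁻¹) • f1) x • ζ3 := by
    intro x
    conv_lhs => rw [hexp x]
    conv_rhs => rw [hez]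
    simp only [B_sub_l, B_smul_l]
    ext i
    simp
    field_simp
    ring
  have s13 : ∀ g : Γ₀, ¬ (0 < Bform (f1 - (a * b⁻¹) • f2) (orb g) ∧
      0 < Bform (f3 - (c * b⁻¹) • f2) (orb g)) := by
    rcases sector h hS hL1 hL hz hz2 l1 t1 l3 t3 e13 r1 r3 with H | H
    · exfalso
      have := c2 _ (fun g => (H g).1.le)
      rw [B_sub_l, B_smul_l, d12, d22] at this
      have : 0 < a * b⁻¹ := by positivity
      linarith
    · exact H
  have s23 : ∀ g : Γ₀, ¬ (0 < Bform (f2 - (b * a⁻¹) • f1) (orb g) ∧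
      0 < Bform (f3 - (c * a⁻¹) • f1) (orb g)) := by
    rcases sector h hS hL1 hL hz hz2 l2 t2 l3 t3 e23 r2 r3 with H | H
    · exfalso
      have := c1 _ (fun g => (H g).1.le)
      rw [B_sub_l, B_smul_l, d21, d11] at this
      have : 0 < b * a⁻¹ := by positivity
      linarith
    · exact H
  -- orbit points are not on the ray to ζ3
  have nr : ∀ (g : Γ₀) (w d : ℝ), 0 ≤ d → orb g ≠ w • z + d • ζ3 := by
    intro g w d hd he
    have hw : 0 < w := by
      have e := congrArg (fun v => Bform v ζ3) he
      simp only [B_add_l, B_smul_l, l3] at e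
      have := pair_neg (by rw [orb_B h]; norm_num) (orb_two h g) ⟨l3.le, t3.le⟩ t3
      by_contra hc; push Not at hc; nlinarith
    have := r3.scale hw hd g
    rw [← he, orb_B h] at this
    nlinarith
  have fin : ∀ g : Γ₀,
      (Bform f1 (orb g) * a⁻¹ ≤ Bform f2 (orb g) * b⁻¹ ∧
        Bform f3 (orb g) ≤ c * (Bform f1 (orb g) * a⁻¹)) ∨
      (Bform f2 (orb g) * b⁻¹ ≤ Bform f1 (orb g) * a⁻¹ ∧
        Bform f3 (orb g) ≤ c * (Bform f2 (orb g) * b⁻¹)) := by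
    intro g
    rcases le_total (Bform f1 (orb g) * a⁻¹) (Bform f2 (orb g) * b⁻¹) with hle | hle
    · left
      refine ⟨hle, ?_⟩
      by_contra hcon
      push Not at hcon
      have hC : 0 < Bform (f3 - (c * a⁻¹) • f1) (orb g) := by
        rw [B_sub_l, B_smul_l]; linarith
      have hA : 0 ≤ Bform (f2 - (b * a⁻¹) • f1) (orb g) := by
        rw [B_sub_l, B_smul_l]
        have := mul_le_mul_of_nonneg_left hle p2.le
        have e : b * (Bform f2 (orb g) * b⁻¹) = Bform f2 (orb g) := by field_simp
        linarith
      rcases hA.lt_or_eq with hA | hA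
      · exact s23 g ⟨hA, hC⟩
      · have := e23 (orb g)
        rw [← hA, zero_smul, add_zero] at this
        exact nr g _ _ hC.le this
    · right
      refine ⟨hle, ?_⟩
      by_contra hcon
      push Not at hcon
      have hC : 0 < Bform (f3 - (c * b⁻¹) • f2) (orb g) := by
        rw [B_sub_l, B_smul_l]; linarith
      have hA : 0 ≤ Bform (f1 - (a * b⁻¹) • f2) (orb g) := by
        rw [B_sub_l, B_smul_l]
        have := mul_le_mul_of_nonneg_left hle p1.le
        have e : a * (Bform f1 (orb g) * a⁻¹) = Bform f1 (orb g) := by field_simp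
        linarith
      rcases hA.lt_or_eq with hA | hA
      · exact s13 g ⟨hA, hC⟩
      · have := e13 (orb g)
        rw [← hA, zero_smul, add_zero] at this
        exact nr g _ _ hC.le this
  rcases lt_or_ge 0 c with hcp | hcn
  · have := c3 ((c * a⁻¹) • f1 - f3) (by
      intro g
      rw [B_sub_l, B_smul_l]
      rcases fin g with ⟨h1, h2⟩ | ⟨h1, h2⟩
      · linarith
      · have := mul_le_mul_of_nonneg_left h1 hcp.le
        linarith)
    rw [B_sub_l, B_smul_l, d13, d33] at this
    linarith
  · have := c3 ((-1 : ℝ) • f3) (by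
      intro g
      rw [B_smul_l]
      have o1 : Bform (orb g) ζ1 < 0 :=
        pair_neg (by rw [orb_B h]; norm_num) (orb_two h g) ⟨l1.le, t1.le⟩ t1
      have o2 : Bform (orb g) ζ2 < 0 :=
        pair_neg (by rw [orb_B h]; norm_num) (orb_two h g) ⟨l2.le, t2.le⟩ t2
      rcases fin g with ⟨h1, h2⟩ | ⟨h1, h2⟩
      · rcases le_or_gt 0 (Bform f1 (orb g) * a⁻¹) with ht | ht
        · nlinarith
        · exfalso
          have e := congrArg (fun v => Bform v ζ2) (e23 (orb g))
          simp only [B_add_l, B_smul_l, B_sub_l, l2, B_comm ζ3 ζ2] at e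
          have i1 : 0 < a⁻¹ * Bform f1 (orb g) * Bform z ζ2 := by nlinarith
          have i2 : 0 ≤ (Bform f3 (orb g) - c * a⁻¹ * Bform f1 (orb g)) * Bform ζ2 ζ3 :=
            mul_nonneg_of_nonpos_of_nonpos (by linarith) n23.le
          linarith
      · rcases le_or_gt 0 (Bform f2 (orb g) * b⁻¹) with ht | ht
        · nlinarith
        · exfalso
          have e := congrArg (fun v => Bform v ζ1) (e13 (orb g))
          simp only [B_add_l, B_smul_l, B_sub_l, l1, B_comm ζ3 ζ1] at e
          have i1 : 0 < b⁻¹ * Bform f2 (orb g) * Bform z ζ1 := by nlinarith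
          have i2 : 0 ≤ (Bform f3 (orb g) - c * b⁻¹ * Bform f2 (orb g)) * Bform ζ1 ζ3 :=
            mul_nonneg_of_nonpos_of_nonpos (by linarith) n13.le
          linarith)
    rw [B_smul_l, d33] at this
    linarith

lemma two_of_three_pos {a b c u1 u2 u3 : ℝ} (ha : a < 0) (hb : b < 0) (hc : c < 0)
    (z1 : u1 * 0 + u2 * a + u3 * b < 0) (z2 : u1 * a + u2 * 0 + u3 * c < 0)
    (z3 : u1 * b + u2 * c + u3 * 0 < 0) :
    0 < u1 ∧ 0 < u2 ∨ 0 < u1 ∧ 0 < u3 ∨ 0 < u2 ∧ 0 < u3 := by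
  have k12 : ¬ (u1 ≤ 0 ∧ u2 ≤ 0) := fun ⟨p, q⟩ => by nlinarith
  have k13 : ¬ (u1 ≤ 0 ∧ u3 ≤ 0) := fun ⟨p, q⟩ => by nlinarith
  have k23 : ¬ (u2 ≤ 0 ∧ u3 ≤ 0) := fun ⟨p, q⟩ => by nlinarith
  simp only [not_and_or, not_le] at k12 k13 k23
  tauto

lemma three_rays (h : ∀ γ : Γ₀, SO21 (toM γ)) {S : Set Γ₀} (hS : Subgroup.closure S = ⊤)
    {L : ℝ} (hL1 : 1 ≤ L) (hL : ∀ s ∈ S, orb s 2 ≤ L) {z ζ1 ζ2 ζ3 : Fin 3 → ℝ}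
    (hz : Bform z z < 0) (hz2 : 0 < z 2)
    (l1 : Bform ζ1 ζ1 = 0) (t1 : 0 < ζ1 2) (l2 : Bform ζ2 ζ2 = 0) (t2 : 0 < ζ2 2)
    (l3 : Bform ζ3 ζ3 = 0) (t3 : 0 < ζ3 2)
    (n12 : Bform ζ1 ζ2 < 0) (n13 : Bform ζ1 ζ3 < 0) (n23 : Bform ζ2 ζ3 < 0)
    (c1 : InC Γ₀ ζ1) (c2 : InC Γ₀ ζ2) (c3 : InC Γ₀ ζ3)
    (r1 : RayFree Γ₀ (L ^ 2) z ζ1) (r2 : RayFree Γ₀ (L ^ 2) z ζ2) (r3 : RayFree Γ₀ (L ^ 2) z ζ3) :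
    False := by
  obtain ⟨a, ha⟩ : ∃ a, a = Bform ζ1 ζ2 := ⟨_, rfl⟩
  obtain ⟨b, hb⟩ : ∃ a, a = Bform ζ1 ζ3 := ⟨_, rfl⟩
  obtain ⟨c, hc⟩ : ∃ a, a = Bform ζ2 ζ3 := ⟨_, rfl⟩
  have ha' : Bform ζ2 ζ1 = a := by rw [B_comm, ha]
  have hb' : Bform ζ3 ζ1 = b := by rw [B_comm, hb]
  have hc' : Bform ζ3 ζ2 = c := by rw [B_comm, hc]
  rw [← ha] at n12
  rw [← hb] at n13
  rw [← hc] at n23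
  have a0 := n12.ne
  have b0 := n13.ne
  have c0 := n23.ne
  set f1 := (2 * a * b)⁻¹ • (b • ζ2 + a • ζ3 - c • ζ1) with hf1
  set f2 := (2 * a * c)⁻¹ • (c • ζ1 + a • ζ3 - b • ζ2) with hf2
  set f3 := (2 * b * c)⁻¹ • (c • ζ1 + b • ζ2 - a • ζ3) with hf3
  have d11 : Bform f1 ζ1 = 1 := by
    simp only [hf1, B_sub_l, B_add_l, B_smul_l, l1, l2, l3, ha', hb', hc', ← ha, ← hb, ← hc]; field_simp; ring
  have d12 : Bform f1 ζ2 = 0 := by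
    simp only [hf1, B_sub_l, B_add_l, B_smul_l, l1, l2, l3, ha', hb', hc', ← ha, ← hb, ← hc]; field_simp; ring
  have d13 : Bform f1 ζ3 = 0 := by
    simp only [hf1, B_sub_l, B_add_l, B_smul_l, l1, l2, l3, ha', hb', hc', ← ha, ← hb, ← hc]; field_simp; ring
  have d21 : Bform f2 ζ1 = 0 := by
    simp only [hf2, B_sub_l, B_add_l, B_smul_l, l1, l2, l3, ha', hb', hc', ← ha, ← hb, ← hc]; field_simp; ring
  have d22 : Bform f2 ζ2 = 1 := by
    simp only [hf2, B_sub_l, B_add_l, B_smul_l, l1, l2, l3, ha', hb', hc', ← ha, ← hb, ← hc]; field_simp; ring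
  have d23 : Bform f2 ζ3 = 0 := by
    simp only [hf2, B_sub_l, B_add_l, B_smul_l, l1, l2, l3, ha', hb', hc', ← ha, ← hb, ← hc]; field_simp; ring
  have d31 : Bform f3 ζ1 = 0 := by
    simp only [hf3, B_sub_l, B_add_l, B_smul_l, l1, l2, l3, ha', hb', hc', ← ha, ← hb, ← hc]; field_simp; ring
  have d32 : Bform f3 ζ2 = 0 := by
    simp only [hf3, B_sub_l, B_add_l, B_smul_l, l1, l2, l3, ha', hb', hc', ← ha, ← hb, ← hc]; field_simp; ring
  have d33 : Bform f3 ζ3 = 1 := by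
    simp only [hf3, B_sub_l, B_add_l, B_smul_l, l1, l2, l3, ha', hb', hc', ← ha, ← hb, ← hc]; field_simp; ring
  have hexp : ∀ x, x = Bform f1 x • ζ1 + Bform f2 x • ζ2 + Bform f3 x • ζ3 := by
    intro x
    rw [← sub_eq_zero]
    have hG : (!![Bform ζ1 ζ1, Bform ζ1 ζ2, Bform ζ1 ζ3; Bform ζ2 ζ1, Bform ζ2 ζ2, Bform ζ2 ζ3;
      Bform ζ3 ζ1, Bform ζ3 ζ2, Bform ζ3 ζ3]).det ≠ 0 := by
      rw [l1, l2, l3, ha', hb', hc', ← ha, ← hb, ← hc, Matrix.det_fin_three]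
      simp
      have : a * c * b + b * a * c = 2 * a * b * c := by ring
      rw [this]
      simp [a0, b0, c0]
    apply nondeg hG
    · simp only [hf1, hf2, hf3, B_sub_l, B_add_l, B_smul_l, l1, l2, l3, ha', hb', hc',
        ← ha, ← hb, ← hc, B_comm x ζ1, B_comm x ζ2, B_comm x ζ3]
      field_simp; ring
    · simp only [hf1, hf2, hf3, B_sub_l, B_add_l, B_smul_l, l1, l2, l3, ha', hb', hc',
        ← ha, ← hb, ← hc, B_comm x ζ1, B_comm x ζ2, B_comm x ζ3]
      field_simp; ring
    · simp only [hf1, hf2, hf3, B_sub_l, B_add_l, B_smul_l, l1, l2, l3, ha', hb', hc',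
        ← ha, ← hb, ← hc, B_comm x ζ1, B_comm x ζ2, B_comm x ζ3]
      field_simp; ring
  have hzζ1 := pair_neg hz hz2 ⟨l1.le, t1.le⟩ t1
  have hzζ2 := pair_neg hz hz2 ⟨l2.le, t2.le⟩ t2
  have hzζ3 := pair_neg hz hz2 ⟨l3.le, t3.le⟩ t3
  have z1 := congrArg (fun v => Bform v ζ1) (hexp z)
  have z2 := congrArg (fun v => Bform v ζ2) (hexp z)
  have z3 := congrArg (fun v => Bform v ζ3) (hexp z)
  simp only [B_add_l, B_smul_l, l1, l2, l3, ha', hb', hc', ← ha, ← hb, ← hc] at z1 z2 z3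
  have hc12 : 0 < Bform f1 z ∧ 0 < Bform f2 z ∨ 0 < Bform f1 z ∧ 0 < Bform f3 z ∨
      0 < Bform f2 z ∧ 0 < Bform f3 z := by
    exact two_of_three_pos n12 n13 n23 (z1 ▸ hzζ1) (z2 ▸ hzζ2) (z3 ▸ hzζ3)
  rcases hc12 with ⟨p, q⟩ | ⟨p, q⟩ | ⟨p, q⟩
  · exact three_rays_core h hS hL1 hL hz hz2 l1 t1 l2 t2 l3 t3 (hb ▸ n13) (hc ▸ n23) c1 c2 c3
      r1 r2 r3 hexp d11 d12 d13 d21 d22 d23 d33 p q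
  · exact three_rays_core h hS hL1 hL hz hz2 l1 t1 l3 t3 l2 t2 (ha ▸ n12) (hc' ▸ n23) c1 c3 c2
      r1 r3 r2 (fun x => by rw [add_right_comm]; exact hexp x) d11 d13 d12 d31 d33 d32 d22 p q
  · exact three_rays_core h hS hL1 hL hz hz2 l2 t2 l3 t3 l1 t1 (ha' ▸ n12) (hb' ▸ n13) c2 c3 c1
      r2 r3 r1 (fun x => by rw [add_comm, ← add_assoc]; exact hexp x) d22 d23 d21 d32 d33 d31 d11 p q

end tri

section vis
variable {Γ₀ : Subgroup (Matrix (Fin 3) (Fin 3) ℝ)ˣ}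

lemma RayFree.act (h : ∀ γ : Γ₀, SO21 (toM γ)) {M : ℝ} {z ζ : Fin 3 → ℝ}
    (H : RayFree Γ₀ M z ζ) (g : Γ₀) : RayFree Γ₀ M (act g z) (act g ζ) := by
  intro t ht k
  rw [← act_smul, ← act_add, B_act h, B_act_l h, ← orb_mul]
  exact H t ht _

lemma visible (h : ∀ γ : Γ₀, SO21 (toM γ)) {ξ : Fin 3 → ℝ} (x2 : ξ 2 = 1)
    (xl : Bform ξ ξ = 0) (xo : ∀ g : Γ₀, Bform ξ (orb g) ≤ -1/2) {M : ℝ} (hM : 1 ≤ M)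
    (k0 : Γ₀) : ∃ (g : Γ₀) (w : Fin 3 → ℝ) (lam t : ℝ), 0 < lam ∧ 0 ≤ t ∧ w 2 = 1 ∧
      1 ≤ 3 * M * (- Bform w w) ∧ orb k0 + t • ξ = lam • act g w ∧
      RayFree Γ₀ M w (act g⁻¹ ξ) := by
  set x := orb k0 with hx
  obtain ⟨m, hm⟩ : ∃ m, m = - Bform ξ x := ⟨_, rfl⟩
  have hm2 : 1/2 ≤ m := by rw [hm]; linarith [xo k0]
  have hxx : Bform x x = -1 := orb_B h k0
  have hxm : Bform x ξ = -m := by rw [hm, B_comm]; ring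
  have hxm' : Bform ξ x = -m := by rw [hm]; ring
  have q : ∀ t : ℝ, - Bform (x + t • ξ) (x + t • ξ) = 1 + 2 * t * m := by
    intro t
    simp only [B_add_l, B_add_r, B_smul_l, B_smul_r, hxx, hxm, hxm', xl]; ring
  have xf : Fut ξ := ⟨xl.le, by rw [x2]; norm_num⟩
  have lin : ∀ (t : ℝ) (g : Γ₀), Bform (x + t • ξ) (orb g) = Bform x (orb g) + t * Bform ξ (orb g) := by
    intro t g; simp only [B_add_l, B_smul_l]
  have xn : ∀ g : Γ₀, Bform x (orb g) ≤ 0 := fun g => fut_pair (orb_fut h k0) (orb_fut h g)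
  set T : Set ℝ := {t | 0 ≤ t ∧ ∃ g : Γ₀, (Bform (x + t • ξ) (orb g)) ^ 2 ≤
    M * (- Bform (x + t • ξ) (x + t • ξ))} with hT
  have h0 : (0:ℝ) ∈ T := by
    refine ⟨le_rfl, k0, ?_⟩
    rw [q, lin]
    rw [← hx, hxx]; nlinarith
  have hbd : BddAbove T := by
    refine ⟨8 * M * m + 4 * M + 1, ?_⟩
    rintro t ⟨ht, g, hg⟩
    rw [q, lin] at hg
    by_contra hc
    push Not at hc
    have a1 : (t/2)^2 ≤ (Bform x (orb g) + t * Bform ξ (orb g))^2 := by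
      have := mul_le_mul_of_nonneg_left (xo g) ht
      have := xn g
      nlinarith
    have : 0 < M * m := by positivity
    nlinarith
  have mpos : 0 < m := by linarith
  obtain ⟨t, htT, hts⟩ := exists_lt_of_lt_csSup ⟨0, h0⟩
    (show sSup T - 1 / m < sSup T by have : 0 < 1 / m := by positivity
                                     linarith)
  obtain ⟨ht, g, hg⟩ := htT
  obtain ⟨τ, hτ⟩ : ∃ τ, τ = (1 + 2 * t * m) / m := ⟨_, rfl⟩
  have hτm : τ * m = 1 + 2 * t * m := by rw [hτ]; field_simp
  have hτ1 : 1 / m ≤ τ := by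
    rw [hτ]; gcongr; nlinarith
  have hτ0 : 0 < τ := lt_of_lt_of_le (by positivity) hτ1
  have hy2 : ∀ s : ℝ, 0 ≤ s → 0 < (x + s • ξ) 2 := by
    intro s hs
    have := orb_two h k0
    simp [x2, ← hx] at *
    linarith
  have hyq : ∀ s : ℝ, 0 ≤ s → Bform (x + s • ξ) (x + s • ξ) < 0 := by
    intro s hs
    have := q s
    nlinarith
  have hray : RayFree Γ₀ M (x + (t + τ) • ξ) ξ := by
    intro s hs k
    by_contra hc
    push Not at hc
    have e : x + (t + τ) • ξ + s • ξ = x + (t + τ + s) • ξ := by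
      rw [add_assoc, ← add_smul]
    rw [e] at hc
    have : t + τ + s ∈ T := ⟨by linarith, k, hc⟩
    have := le_csSup hbd this
    linarith
  set y := act g⁻¹ (x + (t + τ) • ξ) with hy
  have hyy : y 2 = - Bform (x + (t + τ) • ξ) (orb g) := act_inv_two h g _
  have hyp : 0 < y 2 := act_two_pos h _ (hyq _ (by linarith)) (hy2 _ (by linarith))
  have hr2 : RayFree Γ₀ M y (act g⁻¹ ξ) := hray.act h g⁻¹
  refine ⟨g, (y 2)⁻¹ • y, y 2, t + τ, hyp, by linarith, ?_, ?_, ?_, ?_⟩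
  · simp [hyp.ne']
  · have hc := crude_orb h g (hyq t ht) (hy2 t ht) xl.le (by linarith [xo g])
    have e : Bform (x + t • ξ) ξ = -m := by simp only [B_add_l, B_smul_l, hxm, xl]; ring
    rw [e, q t] at hc
    rw [q t] at hg
    have hyle : y 2 ≤ 3 * (- Bform (x + t • ξ) (orb g)) := by
      rw [hyy, lin]
      rw [lin] at hc ⊢
      have : τ * (-Bform ξ (orb g)) ≤ 2 * (- (Bform x (orb g) + t * Bform ξ (orb g))) := by
        rw [← hτm] at hc
        have hc' : m * (τ * -Bform ξ (orb g)) ≤ m * (2 * (-(Bform x (orb g) + t * Bform ξ (orb g)))) := by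
          linarith
        exact le_of_mul_le_mul_left hc' mpos
      linarith
    have hyB : - Bform y y = 3 * (1 + 2 * t * m) := by
      rw [hy, B_act h, q]; linarith
    rw [B_smul_l, B_smul_r]
    have : y 2 ^ 2 ≤ 3 * M * (- Bform y y) := by
      rw [hyB]
      calc y 2 ^ 2 ≤ (3 * (- Bform (x + t • ξ) (orb g)))^2 := by gcongr
        _ ≤ _ := by nlinarith
    have e2 : 3 * M * -((y 2)⁻¹ * ((y 2)⁻¹ * Bform y y)) = (3 * M * (- Bform y y)) / (y 2)^2 := by
      field_simp
    rw [e2, le_div_iff₀ (by positivity)]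
    linarith
  · rw [act_smul, smul_smul, mul_inv_cancel₀ hyp.ne', one_smul, hy, act_act_inv]
  · intro s hs k
    exact hr2.scale (inv_pos.2 hyp) hs k

/-- infinitely many visible positions -/
lemma visible_inf (h : ∀ γ : Γ₀, SO21 (toM γ)) {ξ : Fin 3 → ℝ} (x2 : ξ 2 = 1)
    (xl : Bform ξ ξ = 0) (xo : ∀ g : Γ₀, Bform ξ (orb g) ≤ -1/2) (xC : InC Γ₀ ξ) {M : ℝ}
    (hM : 1 ≤ M) : {g : Γ₀ | ∃ w : Fin 3 → ℝ, w 2 = 1 ∧ 1 ≤ 3 * M * (- Bform w w) ∧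
      RayFree Γ₀ M w (act g⁻¹ ξ)}.Infinite := by
  intro hfin
  set F := {g : Γ₀ | ∃ w : Fin 3 → ℝ, w 2 = 1 ∧ 1 ≤ 3 * M * (- Bform w w) ∧
      RayFree Γ₀ M w (act g⁻¹ ξ)} with hF
  obtain ⟨D, hD⟩ := (hfin.image (fun g => orb g⁻¹ 2)).bddAbove
  have xf : Fut ξ := ⟨xl.le, by rw [x2]; norm_num⟩
  have key : ∀ k : Γ₀, orb k 2 ≤ 24 * M * D ^ 2 * (- Bform ξ (orb k)) := by
    intro k
    obtain ⟨g, w, lam, t, hl, ht, w2, wM, he, hr⟩ := visible h x2 xl xo hM k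
    have gD : orb g⁻¹ 2 ≤ D := hD ⟨g, ⟨w, w2, wM, hr⟩, rfl⟩
    have gp := orb_two h g⁻¹
    have wB : Bform w w < 0 := by
      by_contra hc; push Not at hc; nlinarith
    -- v = act g w
    have wf : Fut w := ⟨wB.le, by rw [w2]; norm_num⟩
    have v2 : act g w 2 ≤ 2 * D := by
      have h1 := crude (x := oo) (w := w) ⟨by simp [Bform, oo], by simp [oo]⟩ wf
      have h2 := act_inv_two h g⁻¹ w
      rw [inv_inv] at h2
      have h3 := cs2 w (orb g⁻¹)
      have h4 := sq_of_fut wf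
      have h5 := sq_of_fut (orb_fut h g⁻¹)
      have h6 := mul_le_mul h4 h5 (Real.sqrt_nonneg _) wf.2
      rw [h2]
      have h7 : - Bform w (orb g⁻¹) ≤ 2 * (w 2 * orb g⁻¹ 2) := by
        have h8 := cs2 (-w) (orb g⁻¹)
        simp at h8
        simp only [Bform]
        linarith
      rw [w2] at h7; linarith
    have vp : 0 < act g w 2 := act_two_pos h g wB (by rw [w2]; norm_num)
    have vB : Bform (act g w) (act g w) = Bform w w := B_act h _ _ _
    have h1 := crude (x := act g w) (w := ξ) ⟨by rw [vB]; exact wB.le, vp.le⟩ xf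
    rw [vB, x2, mul_one] at h1
    -- ⟨v,ξ⟩ lower bound
    have hp : 0 ≤ - Bform (act g w) ξ := by
      have := fut_pair (x := act g w) ⟨by rw [vB]; exact wB.le, vp.le⟩ xf; linarith
    have h2 : 1 ≤ 12 * M * D * (- Bform (act g w) ξ) := by
      have := mul_le_mul_of_nonneg_right v2 hp
      have := mul_le_mul_of_nonneg_left this (show 0 ≤ 6 * M by linarith)
      have := mul_le_mul_of_nonneg_left h1 (show 0 ≤ 3 * M by linarith)
      linarith
    have e1 : Bform ξ (orb k) = lam * Bform (act g w) ξ := by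
      rw [← B_smul_l, ← he, B_add_l, B_smul_l, xl, B_comm]; ring
    have e2 : orb k 2 ≤ lam * act g w 2 := by
      have := congrFun he 2
      simp [x2] at this
      linarith
    have hD0 : 0 < D := gp.trans_le gD
    calc orb k 2 ≤ lam * act g w 2 := e2
      _ ≤ lam * (2 * D) := by gcongr
      _ = lam * (2 * D) * 1 := by ring
      _ ≤ lam * (2 * D) * (12 * M * D * (- Bform (act g w) ξ)) := by gcongr
      _ = _ := by rw [e1]; ring
  have := xC ((-(24 * M * D ^ 2)) • ξ + oo) (by
    intro g
    have := key g
    rw [B_add_l, B_smul_l, B_comm oo, B_oo]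
    linarith)
  rw [B_add_l, B_smul_l, xl, B_comm, B_oo, x2] at this
  linarith
end vis

section horo
variable {Γ₀ : Subgroup (Matrix (Fin 3) (Fin 3) ℝ)ˣ}

lemma RayFree.perturb (h : ∀ γ : Γ₀, SO21 (toM γ)) {M : ℝ} (hM : 0 ≤ M) {w w' ζ : Fin 3 → ℝ}
    (H : RayFree Γ₀ (16 * M) w' ζ) (fw : Fut w) (fw' : Fut w') (fζ : Fut ζ)
    (h1 : Fut ((2:ℝ) • w - w')) (h2 : Fut ((2:ℝ) • w' - w)) : RayFree Γ₀ M w ζ := by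
  intro t ht g
  have H := H t ht g
  have ft := fut_smul fζ ht
  have a1 := fut_pair (fut_add h1 ft) (orb_fut h g)
  have e1 : (2:ℝ) • w - w' + t • ζ = (2:ℝ) • (w + t • ζ) - (w' + t • ζ) := by module
  rw [e1, B_sub_l, B_smul_l] at a1
  have a2 := fut_q (fut_add fw ft) (fut_add h2 ft)
  have e2 : w + t • ζ + ((2:ℝ) • w' - w + t • ζ) = (2:ℝ) • (w' + t • ζ) := by module
  rw [e2, B_smul_l, B_smul_r] at a2
  have a3 := fut_pair (fut_add fw' ft) (orb_fut h g)
  generalize Bform (w + t • ζ) (orb g) = p at *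
  generalize Bform (w' + t • ζ) (orb g) = p' at *
  have := mul_le_mul_of_nonneg_left a2 hM
  nlinarith

lemma eig_light (h : ∀ γ : Γ₀, SO21 (toM γ)) {g : Γ₀} {v : Fin 3 → ℝ} {lam : ℝ} (hl : 1 < lam)
    (hv : act g v = lam • v) : Bform v v = 0 := by
  have := B_act h g v v
  rw [hv, B_smul_l, B_smul_r] at this
  have h2 : (lam * lam - 1) * Bform v v = 0 := by linarith
  rcases mul_eq_zero.1 h2 with h3 | h3
  · nlinarith
  · exact h3

lemma light_two_ne {v : Fin 3 → ℝ} (hv : Bform v v = 0) (h0 : v ≠ 0) : v 2 ≠ 0 := by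
  intro h2
  apply h0
  simp only [Bform, h2] at hv
  ext i; fin_cases i
  · simp; nlinarith [sq_nonneg (v 0), sq_nonneg (v 1)]
  · simp; nlinarith [sq_nonneg (v 0), sq_nonneg (v 1)]
  · simpa using h2

lemma act_pow_eig {k : Γ₀} {ξ : Fin 3 → ℝ} {c : ℝ} (hk : act k ξ = c • ξ) (n : ℕ) :
    act (k ^ n) ξ = c ^ n • ξ := by
  induction n with
  | zero => simp [act_one]
  | succ n ih => rw [pow_succ, act_mul, hk, act_smul, ih, smul_smul, pow_succ]; congr 1; ring

lemma stab_aux (h : ∀ γ : Γ₀, SO21 (toM γ)) {ξ : Fin 3 → ℝ} (x2 : ξ 2 = 1)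
    (xo : ∀ g : Γ₀, Bform ξ (orb g) ≤ -1/2) {k : Γ₀} {c : ℝ}
    (hk : act k ξ = c • ξ) : 1 ≤ c := by
  have key : ∀ n : ℕ, 1/2 ≤ c ^ n := by
    intro n
    have h1 := act_pow_eig hk n
    have h2 := act_inv_two h (k ^ n)⁻¹ ξ
    rw [inv_inv, h1] at h2
    simp [x2] at h2
    linarith [xo (k ^ n)⁻¹]
  by_contra hc
  push Not at hc
  have := key 1
  obtain ⟨n, hn⟩ := exists_pow_lt_of_lt_one (show (0:ℝ) < 1/2 by norm_num) hc
  linarith [key n]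

lemma stab (h : ∀ γ : Γ₀, SO21 (toM γ)) (hyp : ∀ γ : Γ₀, γ ≠ 1 → IsHyperbolic (toM γ))
    {ξ : Fin 3 → ℝ} (x2 : ξ 2 = 1) (xl : Bform ξ ξ = 0)
    (xo : ∀ g : Γ₀, Bform ξ (orb g) ≤ -1/2) {k : Γ₀} (k1 : k ≠ 1) {c : ℝ}
    (hk : act k ξ = c • ξ) : False := by
  have c1 := stab_aux h x2 xo hk
  have hk' : act k⁻¹ ξ = c⁻¹ • ξ := by
    have := act_inv_act k ξ
    rw [hk, act_smul] at this
    rwa [eq_inv_smul_iff₀ (by linarith)]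
  have c2 := stab_aux h x2 xo hk'
  have c3 : c = 1 := le_antisymm ((one_le_inv₀ (by linarith)).1 c2) c1
  rw [c3, one_smul] at hk
  obtain ⟨lam, hl, v, v0, hv⟩ := hyp k k1
  change act k v = _ at hv
  have vl := eig_light h hl hv
  have hB := B_act h k v ξ
  rw [hv, hk, B_smul_l] at hB
  have hB0 : Bform v ξ = 0 := by
    have : (lam - 1) * Bform v ξ = 0 := by linarith
    rcases mul_eq_zero.1 this with h3 | h3
    · linarith
    · exact h3
  have hp := light_prop vl xl hB0
  rw [x2, one_smul] at hp
  have v2 := light_two_ne vl v0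
  rw [hp, act_smul, hk, smul_smul] at hv
  have := congrFun hv 2
  simp [x2] at this
  exact v2 (by nlinarith [mul_self_nonneg (v 2), mul_self_pos.2 v2])

lemma B_cont {X : Type*} [TopologicalSpace X] {f g : X → Fin 3 → ℝ} (hf : Continuous f)
    (hg : Continuous g) : Continuous (fun x => Bform (f x) (g x)) := by
  unfold Bform; fun_prop

lemma compact_of {K : Set (Fin 3 → ℝ)} (hc : IsClosed K) (hb : ∀ v ∈ K, v 2 = 1 ∧ Bform v v ≤ 1) :
    IsCompact K := by
  apply (isCompact_univ_pi (fun _ : Fin 3 => isCompact_Icc (a := (-2:ℝ)) (b := 2))).of_isClosed_subset hc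
  intro v hv i _
  have h1 := hb v hv
  have := coord_bound (R := 1) h1.2 (by rw [h1.1]; simp) i
  rw [abs_le] at this
  constructor <;> linarith [this.1, this.2]

lemma no_horo (hS : IsSchottky Γ₀) (hFG : Group.FG Γ₀) {ξ : Fin 3 → ℝ} (x2 : ξ 2 = 1)
    (xl : Bform ξ ξ = 0) (xo : ∀ g : Γ₀, Bform ξ (orb g) ≤ -1/2) (xC : InC Γ₀ ξ) : False := by
  obtain ⟨h, -, -, hyp⟩ := hS
  obtain ⟨S, hSc, hSf⟩ := Group.fg_iff.1 hFG
  obtain ⟨D, hD⟩ := (hSf.image (fun g => orb g 2)).bddAbove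
  obtain ⟨L, hL⟩ : ∃ L, L = max 1 D := ⟨_, rfl⟩
  have hL1 : 1 ≤ L := by rw [hL]; exact le_max_left _ _
  have hLS : ∀ s ∈ S, orb s 2 ≤ L := fun s hs => by
    rw [hL]; exact (hD ⟨s, hs, rfl⟩).trans (le_max_right _ _)
  have hM : 1 ≤ 16 * L ^ 2 := by nlinarith
  have hinf := visible_inf h x2 xl xo xC hM
  set gs := hinf.natEmbedding with hgs
  have hprop : ∀ n, ∃ w : Fin 3 → ℝ, w 2 = 1 ∧ 1 ≤ 3 * (16 * L ^ 2) * (- Bform w w) ∧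
      RayFree Γ₀ (16 * L ^ 2) w (act (gs n : Γ₀)⁻¹ ξ) := fun n => (gs n).2
  choose w w2 wM wr using hprop
  set K : Set (Fin 3 → ℝ) := {v | v 2 = 1 ∧ 1 ≤ 3 * (16 * L ^ 2) * (- Bform v v)} with hK
  have Kneg : ∀ v ∈ K, Bform v v < 0 := by
    rintro v ⟨-, hv⟩
    by_contra hc; push Not at hc
    nlinarith [sq_nonneg L]
  have hKc : IsCompact K := by
    apply compact_of
    · apply IsClosed.inter
      · exact isClosed_eq (by fun_prop) continuous_const
      · exact isClosed_le continuous_const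
          (continuous_const.mul (B_cont continuous_id continuous_id).neg)
    · intro v hv
      exact ⟨hv.1, by linarith [Kneg v hv]⟩
  obtain ⟨z, hz, φ, hφ, hlim⟩ := hKc.tendsto_subseq (x := w) (fun n => ⟨w2 n, wM n⟩)
  have zneg := Kneg z hz
  have z2 : z 2 = 1 := hz.1
  have ez : (2:ℝ) • z - z = z := by module
  have ev1 : ∀ᶠ v in nhds z, Bform ((2:ℝ) • z - v) ((2:ℝ) • z - v) < 0 := by
    have hc : Continuous fun v : Fin 3 → ℝ => Bform ((2:ℝ) • z - v) ((2:ℝ) • z - v) :=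
      B_cont (by fun_prop) (by fun_prop)
    exact hc.continuousAt.eventually_lt continuousAt_const (by simpa only [ez] using zneg)
  have ev2 : ∀ᶠ v in nhds z, Bform ((2:ℝ) • v - z) ((2:ℝ) • v - z) < 0 := by
    have hc : Continuous fun v : Fin 3 → ℝ => Bform ((2:ℝ) • v - z) ((2:ℝ) • v - z) :=
      B_cont (by fun_prop) (by fun_prop)
    exact hc.continuousAt.eventually_lt continuousAt_const (by simpa only [ez] using zneg)
  obtain ⟨N, hN⟩ := Filter.eventually_atTop.1 (hlim.eventually (ev1.and ev2))
  have ζl : ∀ g : Γ₀, Bform (act g⁻¹ ξ) (act g⁻¹ ξ) = 0 := fun g => by rw [B_act h, xl]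
  have ζ2 : ∀ g : Γ₀, 0 < act g⁻¹ ξ 2 := fun g => by rw [act_inv_two h]; linarith [xo g]
  have ray : ∀ n, N ≤ n → RayFree Γ₀ (L ^ 2) z (act (gs (φ n) : Γ₀)⁻¹ ξ) := by
    intro n hn
    obtain ⟨e1, e2⟩ := hN n hn
    simp only [Function.comp] at e1 e2
    have wneg := Kneg (w (φ n)) ⟨w2 _, wM _⟩
    apply RayFree.perturb h (by positivity) (wr (φ n)) ⟨zneg.le, by rw [z2]; norm_num⟩
      ⟨wneg.le, by rw [w2]; norm_num⟩ ⟨(ζl _).le, (ζ2 _).le⟩ ⟨e1.le, ?_⟩ ⟨e2.le, ?_⟩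
    · simp [w2, z2]
    · simp [w2, z2]
  have pr : ∀ i j, i ≠ j → Bform (act (gs i : Γ₀)⁻¹ ξ) (act (gs j : Γ₀)⁻¹ ξ) < 0 := by
    intro i j hij
    apply light_pair_neg (ζl _) (ζl _) (ζ2 _) (ζ2 _)
    intro c hc
    have hne : (gs j : Γ₀) * (gs i : Γ₀)⁻¹ ≠ 1 := by
      intro h1
      rw [mul_inv_eq_one] at h1
      exact hij (gs.injective (Subtype.ext h1)).symm
    apply stab h hyp x2 xl xo hne (c := c)
    rw [act_mul, hc, act_smul, act_act_inv]
  have hne : ∀ a b : ℕ, a ≠ b → φ a ≠ φ b := fun a b hab h => hab (hφ.injective h)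
  exact three_rays h hSc hL1 hLS zneg (by rw [z2]; norm_num) (ζl _) (ζ2 _) (ζl _) (ζ2 _) (ζl _)
    (ζ2 _) (pr _ _ (hne N (N+1) (by omega))) (pr _ _ (hne N (N+2) (by omega)))
    (pr _ _ (hne (N+1) (N+2) (by omega))) (InC_act h _ xC) (InC_act h _ xC) (InC_act h _ xC)
    (ray N le_rfl) (ray (N+1) (by omega)) (ray (N+2) (by omega))
end horo

section lemB
variable {Γ₀ : Subgroup (Matrix (Fin 3) (Fin 3) ℝ)ˣ}

lemma near_min (f : Γ₀ → ℝ) (hf : ∀ g, 1 ≤ f g) : ∃ g0, ∀ g, f g0 ≤ 2 * f g := by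
  have hb : BddBelow (Set.range f) := ⟨1, by rintro _ ⟨g, rfl⟩; exact hf g⟩
  have hI : 1 ≤ sInf (Set.range f) := le_csInf ⟨f 1, 1, rfl⟩ (by rintro _ ⟨g, rfl⟩; exact hf g)
  obtain ⟨_, ⟨g0, rfl⟩, h0⟩ := exists_lt_of_csInf_lt (s := Set.range f) ⟨f 1, 1, rfl⟩
    (show sInf (Set.range f) < 2 * sInf (Set.range f) by linarith)
  refine ⟨g0, fun g => ?_⟩
  have := csInf_le hb ⟨g, rfl⟩
  linarith

lemma InC_smul {v : Fin 3 → ℝ} (hv : InC Γ₀ v) {t : ℝ} (ht : 0 ≤ t) : InC Γ₀ (t • v) := by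
  intro f hf
  rw [B_smul_r]
  exact mul_nonneg ht (hv f hf)

lemma InC_add {v w : Fin 3 → ℝ} (hv : InC Γ₀ v) (hw : InC Γ₀ w) : InC Γ₀ (v + w) := by
  intro f hf
  rw [B_add_r]
  exact add_nonneg (hv f hf) (hw f hf)

lemma InC_lim {p : ℕ → Fin 3 → ℝ} {v : Fin 3 → ℝ} (hp : ∀ n, InC Γ₀ (p n))
    (hl : Filter.Tendsto p Filter.atTop (nhds v)) : InC Γ₀ v := by
  intro f hf
  have hc : Continuous fun v => Bform f v := B_cont continuous_const continuous_id
  exact ge_of_tendsto' ((hc.tendsto v).comp hl) (fun n => hp n f hf)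

lemma lemmaB (hS : IsSchottky Γ₀) (hFG : Group.FG Γ₀) : ∃ R : ℝ, 1 ≤ R ∧ ∀ p : Fin 3 → ℝ,
    Bform p p = -1 → 0 < p 2 → InC Γ₀ p → ∃ g : Γ₀, - Bform p (orb g) ≤ R := by
  by_contra hcon
  push Not at hcon
  have h := hS.1
  have hq : ∀ n : ℕ, ∃ q : Fin 3 → ℝ, q 2 = 1 ∧ -(1 / ((n:ℝ) + 1)) ≤ Bform q q ∧ Bform q q ≤ 0 ∧
      (∀ g : Γ₀, Bform q (orb g) ≤ -1/2) ∧ InC Γ₀ q := by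
    intro n
    have hn : (0:ℝ) ≤ n := n.cast_nonneg
    obtain ⟨p, hp, hp2, hpC, hpg⟩ := hcon (n + 1) (by linarith)
    obtain ⟨g0, hg0⟩ := near_min (fun g : Γ₀ => - Bform p (orb g))
      (fun g => by linarith [hpg g])
    obtain ⟨y, hy⟩ : ∃ y, y = act g0⁻¹ p := ⟨_, rfl⟩
    have y2 : y 2 = - Bform p (orb g0) := by rw [hy, act_inv_two h]
    have y2n : n + 1 < y 2 := by rw [y2]; exact hpg g0
    have yp : 0 < y 2 := by linarith
    have yB : Bform y y = -1 := by rw [hy, B_act h, hp]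
    refine ⟨(y 2)⁻¹ • y, by simp [yp.ne'], ?_, ?_, ?_, ?_⟩
    · rw [B_smul_l, B_smul_r, yB]
      have : (y 2)⁻¹ * (y 2)⁻¹ ≤ 1 / ((n:ℝ) + 1) := by
        rw [← mul_inv, inv_eq_one_div]
        apply one_div_le_one_div_of_le (by linarith)
        nlinarith
      linarith
    · rw [B_smul_l, B_smul_r, yB]
      have : 0 < (y 2)⁻¹ * (y 2)⁻¹ := by positivity
      linarith
    · intro g
      rw [B_smul_l, inv_mul_le_iff₀ yp]
      have := hg0 (g0 * g)
      rw [← y2] at this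
      rw [hy, B_act_l h, inv_inv, ← orb_mul, ← hy]
      linarith
    · exact InC_smul (hy ▸ InC_act h _ hpC) (by positivity)
  choose q q2 qa qb qo qC using hq
  have hK : IsCompact {v : Fin 3 → ℝ | v 2 = 1 ∧ Bform v v ≤ 0} := by
    apply compact_of
    · apply IsClosed.inter
      · exact isClosed_eq (by fun_prop) continuous_const
      · exact isClosed_le (B_cont continuous_id continuous_id) continuous_const
    · intro v hv
      exact ⟨hv.1, by linarith [hv.2]⟩
  obtain ⟨ξ, hξ, φ, hφ, hlim⟩ := hK.tendsto_subseq (x := q) (fun n => ⟨q2 n, qb n⟩)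
  refine no_horo hS hFG (ξ := ξ) hξ.1 (le_antisymm hξ.2 ?_) ?_ ?_
  · have hc : Continuous fun v : Fin 3 → ℝ => Bform v v := B_cont continuous_id continuous_id
    have t1 := (hc.tendsto ξ).comp hlim
    have t2 : Filter.Tendsto (fun n => -(1 / ((φ n : ℝ) + 1))) Filter.atTop (nhds 0) := by
      have := (tendsto_one_div_add_atTop_nhds_zero_nat (𝕜 := ℝ)).neg.comp hφ.tendsto_atTop
      simpa [Function.comp_def] using this
    exact le_of_tendsto_of_tendsto' t2 t1 (fun n => qa (φ n))
  · intro g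
    have hc : Continuous fun v : Fin 3 → ℝ => Bform v (orb g) := B_cont continuous_id continuous_const
    exact le_of_tendsto' ((hc.tendsto ξ).comp hlim) (fun n => qo (φ n) g)
  · exact InC_lim (fun n => qC (φ n)) hlim

lemma orb_inv_two (h : ∀ γ : Γ₀, SO21 (toM γ)) (g : Γ₀) : orb g⁻¹ 2 = orb g 2 := by
  rw [orb, act_inv_two h, B_comm, B_oo, neg_neg]

lemma entry_bound (h : ∀ γ : Γ₀, SO21 (toM γ)) {R : ℝ} {g : Γ₀} (hg : orb g 2 ≤ R) (i j : Fin 3) :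
    |toM g i j| ≤ 2 + R := by
  have o2 := orb_two h g
  have e : toM g i j = act g (Pi.single j 1) i := by simp [act]
  have e2 : act g (Pi.single j 1) 2 = - Bform (Pi.single j 1) (orb g⁻¹) := by
    have := act_inv_two h g⁻¹ (Pi.single j 1)
    rwa [inv_inv] at this
  rw [e]
  have hb : |act g (Pi.single j 1) 2| ≤ 1 + R := by
    have hc := coord_bound (v := orb g⁻¹) (R := R) (by rw [orb_B h]; norm_num)
      (by rw [orb_inv_two h, abs_of_pos o2]; exact hg) j
    rw [e2, abs_neg]
    convert hc using 1
    fin_cases j <;> simp [Bform, Pi.single_apply]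
  have := coord_bound (v := act g (Pi.single j 1)) (R := 1 + R) (by
    rw [B_act h]; fin_cases j <;> simp [Bform, Pi.single_apply]) hb i
  linarith

lemma lemmaC (hS : IsSchottky Γ₀) (R : ℝ) : {g : Γ₀ | orb g 2 ≤ R}.Finite := by
  have h := hS.1
  have := hS.2.1
  have hcl : IsClosed (Γ₀ : Set (Matrix (Fin 3) (Fin 3) ℝ)ˣ) := Subgroup.isClosed_of_discrete
  set Bx : Set (Matrix (Fin 3) (Fin 3) ℝ) := {A | ∀ i j, |A i j| ≤ 2 + R} with hBx
  have hB : IsCompact Bx := by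
    have : IsCompact (Set.univ.pi (fun _ : Fin 3 => Set.univ.pi
      (fun _ : Fin 3 => Set.Icc (-(2 + R)) (2 + R)))) :=
      isCompact_univ_pi (fun _ => isCompact_univ_pi (fun _ => isCompact_Icc))
    have e : Bx = Set.univ.pi (fun _ : Fin 3 => Set.univ.pi
      (fun _ : Fin 3 => Set.Icc (-(2 + R)) (2 + R))) := by
      apply Set.ext
      intro A
      simp only [hBx, Set.mem_setOf_eq, abs_le]
      exact ⟨fun H i _ j _ => H i j, fun H i j => H i trivial j trivial⟩
    rw [e]
    exact this
  have hB' : IsCompact (MulOpposite.op '' Bx) := hB.image MulOpposite.continuous_op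
  have hU := (Units.isClosedEmbedding_embedProduct
    (α := Matrix (Fin 3) (Fin 3) ℝ)).isCompact_preimage (hB.prod hB')
  have hV := hcl.isClosedEmbedding_subtypeVal.isCompact_preimage hU
  refine hV.finite_of_discrete.subset ?_
  intro g hg
  refine ⟨fun i j => entry_bound h hg i j, ⟨_, fun i j => entry_bound h (g := g⁻¹) (R := R) ?_ i j, rfl⟩⟩
  rw [orb_inv_two h]; exact hg
end lemB

section fin
variable {Γ₀ : Subgroup (Matrix (Fin 3) (Fin 3) ℝ)ˣ}

lemma perp_bound {x a : Fin 3 → ℝ} {R : ℝ} (hx : Bform x x = 1) (ha : Bform a a = -1)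
    (h0 : Bform x a = 0) (ha2 : 0 < a 2) (hR : a 2 ≤ R) : |x 2| ≤ R := by
  apply abs_le_of_sq_le_sq _ (by linarith)
  simp only [Bform] at *
  have e1 : x 0 ^ 2 + x 1 ^ 2 = 1 + x 2 ^ 2 := by linarith
  have e2 : a 0 ^ 2 + a 1 ^ 2 = a 2 ^ 2 - 1 := by linarith
  have e3 : x 2 * a 2 = x 0 * a 0 + x 1 * a 1 := by linarith
  have e4 : (x 2 * a 2) ^ 2 ≤ (1 + x 2 ^ 2) * (a 2 ^ 2 - 1) := by
    rw [← e1, ← e2, e3]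
    nlinarith [sq_nonneg (x 0 * a 1 - x 1 * a 0)]
  nlinarith

lemma abs_B_le {a b : Fin 3 → ℝ} {Q : ℝ} (hb : ∀ i, |b i| ≤ Q) :
    |Bform a b| ≤ (|a 0| + |a 1| + |a 2|) * Q := by
  have h (i) : |a i * b i| ≤ |a i| * Q := by
    rw [abs_mul]; exact mul_le_mul_of_nonneg_left (hb i) (abs_nonneg _)
  have h0 := abs_le.1 (h 0)
  have h1 := abs_le.1 (h 1)
  have h2 := abs_le.1 (h 2)
  unfold Bform
  rw [abs_le]
  constructor <;> linarith [h0.1, h0.2, h1.1, h1.2, h2.1, h2.2]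

lemma near_step (h : ∀ γ : Γ₀, SO21 (toM γ)) {R : ℝ} {p p' : Fin 3 → ℝ} (hR : 1 ≤ R)
    (hp : Bform p p = -1) (hp2 : 0 < p 2) (hp' : Bform p' p' = -1) (hp2' : 0 < p' 2)
    (hpp : - Bform p p' ≤ 2) {g g' : Γ₀} (hg : - Bform p (orb g) ≤ R)
    (hg' : - Bform p' (orb g') ≤ R) : orb (g⁻¹ * g') 2 ≤ 8 * R ^ 2 := by
  have a1 := crude_orb h g (x := p) (w := orb g') (by linarith) hp2 (orb_fut h g').1
    (fut_pair (orb_fut h _) (orb_fut h _))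
  have pf : Fut p := ⟨by linarith, hp2.le⟩
  have pf' : Fut p' := ⟨by linarith, hp2'.le⟩
  have a2 := crude_orb h g' (x := p') (w := p) (by linarith) hp2' (by linarith)
    (fut_pair pf (orb_fut h _))
  rw [hp] at a1
  rw [hp', B_comm p' p] at a2
  rw [orb_mul, act_inv_two h]
  have b1 := fut_pair pf (orb_fut h g)
  have b2 := fut_pair pf (orb_fut h g')
  have b3 := fut_pair pf' (orb_fut h g')
  have b4 := fut_pair pf pf'
  have c1 : -Bform p' (orb g') * -Bform p p' ≤ R * 2 :=
    mul_le_mul hg' hpp (by linarith) (by linarith)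
  have c2 : -Bform p (orb g) * -Bform p (orb g') ≤ R * (4 * R) :=
    mul_le_mul hg (by linarith) (by linarith) (by linarith)
  nlinarith

lemma cocycle_step (h : ∀ γ : Γ₀, SO21 (toM γ)) {u : Γ₀ → Fin 3 → ℝ} (hu : IsCocycle Γ₀ u)
    {R Mu : ℝ} {p p' x0 : Fin 3 → ℝ} (hR : 1 ≤ R)
    (hMu : ∀ k : Γ₀, orb k 2 ≤ 8 * R ^ 2 → |u k 0| + |u k 1| + |u k 2| ≤ Mu)
    (hp : Bform p p = -1) (hp2 : 0 < p 2) (hp' : Bform p' p' = -1) (hp2' : 0 < p' 2)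
    (hpp : - Bform p p' ≤ 2) (hx : Bform x0 x0 = 1) (hpx : Bform x0 p = 0)
    {g g' : Γ₀} (hg : - Bform p (orb g) ≤ R)
    (hg' : - Bform p' (orb g') ≤ R) :
    |Bform (u g') x0 - Bform (u g) x0| ≤ Mu * (1 + R) := by
  have hk := near_step h hR hp hp2 hp' hp2' hpp hg hg'
  have e : u g' = u g + act g (u (g⁻¹ * g')) := by
    have := hu g (g⁻¹ * g')
    rwa [mul_inv_cancel_left] at this
  rw [e, B_add_l, B_act_l h, add_sub_cancel_left]
  have hx2 : |act g⁻¹ x0 2| ≤ R := by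
    apply perp_bound (a := act g⁻¹ p) (by rw [B_act h, hx]) (by rw [B_act h, hp])
      (by rw [B_act h, hpx]) (act_two_pos h _ (by linarith) hp2)
    rw [act_inv_two h]; exact hg
  have hb := fun i => coord_bound (v := act g⁻¹ x0) (by rw [B_act h, hx]) hx2 i
  exact (abs_B_le hb).trans (mul_le_mul_of_nonneg_right (hMu _ hk) (by linarith))

lemma axis (h : ∀ γ : Γ₀, SO21 (toM γ)) {g : Γ₀} {lam : ℝ} (hl : 1 < lam) {v0 x0 : Fin 3 → ℝ}
    (hv0 : v0 ≠ 0) (hv : act g v0 = lam • v0) (hx : act g x0 = x0) (hxx : Bform x0 x0 = 1) :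
    ∃ v v' : Fin 3 → ℝ, Bform v v = 0 ∧ Bform v' v' = 0 ∧ 0 < v 2 ∧ 0 < v' 2 ∧
      Bform v v' = -1/2 ∧ Bform v x0 = 0 ∧ Bform v' x0 = 0 ∧ act g v = lam • v ∧
      act g v' = lam⁻¹ • v' ∧ ∃ α δ : ℝ, 0 < α ∧ oo = α • v + (1:ℝ) • v' + δ • x0 := by
  have l0 := eig_light h hl hv
  have n0 := light_two_ne l0 hv0
  obtain ⟨v, hvd⟩ : ∃ v, v = (2 * v0 2)⁻¹ • v0 := ⟨_, rfl⟩
  have v2 : v 2 = 1/2 := by rw [hvd]; simp; field_simp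
  have vl : Bform v v = 0 := by rw [hvd, B_smul_l, B_smul_r, l0]; ring
  have vg : act g v = lam • v := by rw [hvd, act_smul, hv, smul_comm]
  have vx : Bform v x0 = 0 := by
    have := B_act h g v x0
    rw [vg, hx, B_smul_l] at this
    have : (lam - 1) * Bform v x0 = 0 := by linarith
    rcases mul_eq_zero.1 this with h3 | h3
    · linarith
    · exact h3
  obtain ⟨b, hb⟩ : ∃ b, b = x0 2 := ⟨_, rfl⟩
  have xo : Bform x0 oo = -b := by rw [B_oo, hb]
  have ox : Bform oo x0 = -b := by rw [B_comm, xo]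
  have vo : Bform v oo = -(1/2) := by rw [B_oo, v2]
  have ov : Bform oo v = -(1/2) := by rw [B_comm, vo]
  have ooo : Bform oo oo = -1 := by rw [B_oo, oo_two]
  have xv : Bform x0 v = 0 := by rw [B_comm, vx]
  obtain ⟨v', hv'⟩ : ∃ v', v' = oo + b • x0 - (1 + b ^ 2) • v := ⟨_, rfl⟩
  have v'l : Bform v' v' = 0 := by
    rw [hv']
    simp only [B_add_l, B_add_r, B_sub_l, B_sub_r, B_smul_l, B_smul_r, xo, ox, vo, ov, ooo, vx, xv,
      vl, hxx]
    ring
  have v'x : Bform v' x0 = 0 := by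
    rw [hv']
    simp only [B_add_l, B_sub_l, B_smul_l, ox, vx, hxx]
    ring
  have vv' : Bform v v' = -1/2 := by
    rw [hv']
    simp only [B_add_r, B_sub_r, B_smul_r, vo, vx, vl]
    ring
  have v'2 : 0 < v' 2 := by
    by_contra hc
    push Not at hc
    have := fut_pair (x := (-1:ℝ) • v') (w := v) ⟨by rw [B_smul_l, B_smul_r, v'l]; simp, by simpa using hc⟩
      ⟨vl.le, by rw [v2]; norm_num⟩
    rw [B_smul_l, B_comm, vv'] at this
    linarith
  have xv' : Bform x0 v' = 0 := by rw [B_comm, v'x]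
  have v'v : Bform v' v = -1/2 := by rw [B_comm, vv']
  have lne : lam ≠ 0 := by linarith
  have gv : Bform (act g v') v = lam⁻¹ * (-1/2) := by
    have := B_act h g v' v
    rw [vg, B_smul_r, v'v] at this
    rw [← this]; field_simp
  have gx : Bform (act g v') x0 = 0 := by
    have := B_act h g v' x0
    rwa [hx, v'x] at this
  obtain ⟨c, hc⟩ : ∃ c, c = -2 * Bform (act g v') v' := ⟨_, rfl⟩
  have hcc : Bform (act g v') v' = -c/2 := by rw [hc]; ring
  have hn : act g v' - lam⁻¹ • v' - c • v = 0 := by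
    apply nondeg (a := v) (b := v') (c := x0)
    · rw [vl, v'l, hxx, vv', v'v, vx, v'x, xv, xv', Matrix.det_fin_three]
      simp
    · simp only [B_sub_l, B_smul_l, gv, v'v, vl]; ring
    · simp only [B_sub_l, B_smul_l, hcc, v'l, vv']; ring
    · simp only [B_sub_l, B_smul_l, gx, v'x, vx]; ring
  have he : act g v' = lam⁻¹ • v' + c • v := by
    rw [sub_sub, sub_eq_zero] at hn; exact hn
  have hc0 : c = 0 := by
    have := B_act h g v' v'
    rw [he, v'l] at this
    simp only [B_add_l, B_add_r, B_smul_l, B_smul_r, v'l, vl, vv', v'v] at this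
    field_simp at this
    simpa [lne] using this
  refine ⟨v, v', vl, v'l, by rw [v2]; norm_num, v'2, vv', vx, v'x, vg, ?_, 1 + b ^ 2, -b, by positivity, ?_⟩
  · rw [he, hc0]; simp
  · rw [hv']; module

lemma InC_orb (g : Γ₀) : InC Γ₀ (orb g) := fun _ hf => hf g

lemma InC_eig {g : Γ₀} {v v' x0 : Fin 3 → ℝ} {lam α β δ : ℝ} (hl : 1 < lam) (hα : 0 < α)
    (he : oo = α • v + β • v' + δ • x0) (hv : act g v = lam • v) (hv' : act g v' = lam⁻¹ • v')
    (hx : act g x0 = x0) : InC Γ₀ v := by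
  have hx' : act g x0 = (1:ℝ) • x0 := by rw [hx, one_smul]
  have key : InC Γ₀ (α • v) := by
    apply InC_lim (p := fun n => (lam⁻¹) ^ n • orb (g ^ n))
    · intro n
      exact InC_smul (InC_orb _) (by positivity)
    · have e : ∀ n : ℕ, (lam⁻¹) ^ n • orb (g ^ n) =
          α • v + (((lam⁻¹) ^ n * (lam⁻¹) ^ n) • (β • v') + ((lam⁻¹) ^ n) • (δ • x0)) := by
        intro n
        rw [orb, he, act_add, act_add, act_smul, act_smul, act_smul, act_pow_eig hv,
          act_pow_eig hv', act_pow_eig hx']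
        have : lam⁻¹ ^ n * lam ^ n = 1 := by rw [← mul_pow, inv_mul_cancel₀ (by linarith), one_pow]
        have e1 : lam⁻¹ ^ n • (α • (lam ^ n • v)) = α • v := by
          rw [smul_comm α, smul_smul, this, one_smul]
        rw [smul_add, smul_add, e1]
        simp only [one_pow, one_smul]
        module
      have t0 : Filter.Tendsto (fun n : ℕ => (lam⁻¹) ^ n) Filter.atTop (nhds 0) :=
        tendsto_pow_atTop_nhds_zero_of_lt_one (by positivity) (inv_lt_one_of_one_lt₀ hl)
      have t1 := (t0.mul t0).smul_const (β • v')
      have t2 := t0.smul_const (δ • x0)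
      have t3 := (t1.add t2).const_add (α • v)
      simp only [mul_zero, zero_smul, add_zero] at t3
      exact t3.congr (fun n => (e n).symm)
  have := InC_smul key (inv_nonneg.2 hα.le)
  rwa [smul_smul, inv_mul_cancel₀ hα.ne', one_smul] at this

lemma eig_lower (hS : IsSchottky Γ₀) (R : ℝ) : ∃ ε : ℝ, 0 < ε ∧ ∀ k : Γ₀, orb k 2 ≤ R →
    ∀ lam : ℝ, 1 < lam → ∀ v : Fin 3 → ℝ, v ≠ 0 → act k v = lam • v → ε ≤ Real.log lam := by
  have hF := lemmaC hS R
  have hfin : (⋃ k ∈ {g : Γ₀ | orb g 2 ≤ R}, {μ : ℝ | Module.End.HasEigenvalue (Matrix.toLin' (toM k)) μ}).Finite :=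
    hF.biUnion (fun k _ => Module.End.finite_hasEigenvalue _)
  obtain ⟨D, hD⟩ := (hfin.image (fun μ => (Real.log μ)⁻¹)).bddAbove
  refine ⟨(max 1 D)⁻¹, by positivity, ?_⟩
  intro k hk lam hl v hv0 hv
  have hlog := Real.log_pos hl
  have : (Real.log lam)⁻¹ ≤ D := by
    apply hD
    refine ⟨lam, ?_, rfl⟩
    simp only [Set.mem_iUnion]
    refine ⟨k, hk, ?_⟩
    apply Module.End.hasEigenvalue_of_hasEigenvector (x := v)
    rw [Module.End.hasEigenvector_iff, Module.End.mem_eigenspace_iff]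
    exact ⟨by simpa [act] using hv, hv0⟩
  apply inv_le_of_inv_le₀ hlog (this.trans (le_max_right _ _))

/-- point on the axis -/
def axp (v v' : Fin 3 → ℝ) (s : ℝ) : Fin 3 → ℝ := Real.exp s • v + Real.exp (-s) • v'

lemma axp_B {v v' : Fin 3 → ℝ} (vl : Bform v v = 0) (vl' : Bform v' v' = 0)
    (vv' : Bform v v' = -1/2) (s t : ℝ) : Bform (axp v v' s) (axp v v' t) = - Real.cosh (s - t) := by
  have v'v : Bform v' v = -1/2 := by rw [B_comm, vv']
  simp only [axp, B_add_l, B_add_r, B_smul_l, B_smul_r, vl, vl', vv', v'v, Real.cosh_eq]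
  have e1 : Real.exp (s - t) = Real.exp s * Real.exp (-t) := by rw [← Real.exp_add, sub_eq_add_neg]
  have e2 : Real.exp (-(s - t)) = Real.exp (-s) * Real.exp t := by
    rw [← Real.exp_add]; congr 1; ring
  rw [e1, e2]; ring

lemma cosh_one_le : Real.cosh 1 ≤ 2 := by
  rw [Real.cosh_eq]
  have h1 := Real.exp_one_lt_three
  have h2 : Real.exp (-1) ≤ 1 := Real.exp_le_one_iff.2 (by norm_num)
  linarith

lemma telescope {c : ℕ → ℝ} {K : ℝ} (n : ℕ) (hc : ∀ k, |c (k + 1) - c k| ≤ K) :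
    |c n - c 0| ≤ n * K := by
  induction n with
  | zero => simp
  | succ n ih =>
    have e : c (n + 1) - c 0 = (c (n + 1) - c n) + (c n - c 0) := by ring
    rw [e]
    push_cast
    linarith [abs_add_le (c (n + 1) - c n) (c n - c 0), hc n]

end fin

/-- for a finitely generated Schottky group `Γ₀` and a cocycle `u`, the
Margulis invariant grows at most linearly in the translation length
`ℓ(γ) = log λ(γ)`: there is `C > 0` with `|α_u(γ)| ≤ C·ℓ(γ)` for all nontrivial `γ`. -/
theorem stmt_16 (Γ₀ : Subgroup (Matrix (Fin 3) (Fin 3) ℝ)ˣ) (hS : IsSchottky Γ₀)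
    (hFG : Group.FG Γ₀) (u : Γ₀ → Fin 3 → ℝ) (hu : IsCocycle Γ₀ u) :
    ∃ C : ℝ, 0 < C ∧ ∀ γ : Γ₀, γ ≠ 1 →
      ∀ lam : ℝ, 1 < lam → (∃ v : Fin 3 → ℝ, v ≠ 0 ∧ (toM γ).mulVec v = lam • v) →
      ∀ x0 : Fin 3 → ℝ, IsNeutral (toM γ) x0 →
        |Bform (u γ) x0| ≤ C * Real.log lam := by
  have h := hS.1
  obtain ⟨R, hR, hB⟩ := lemmaB hS hFG
  obtain ⟨Mu, hMu⟩ := ((lemmaC hS (8 * R ^ 2)).image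
    (fun k => |u k 0| + |u k 1| + |u k 2|)).bddAbove
  have hMu' : ∀ k : Γ₀, orb k 2 ≤ 8 * R ^ 2 → |u k 0| + |u k 1| + |u k 2| ≤ Mu :=
    fun k hk => hMu ⟨k, hk, rfl⟩
  have hMu0 : 0 ≤ Mu := by
    refine le_trans (by positivity) (hMu' 1 ?_)
    rw [orb, act_one, oo_two]; nlinarith
  obtain ⟨ε, hε, hεl⟩ := eig_lower hS (8 * R ^ 2)
  obtain ⟨K, hK⟩ : ∃ K, K = Mu * (1 + R) + 1 := ⟨_, rfl⟩
  have hK0 : 0 < K := by rw [hK]; positivity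
  obtain ⟨e0, he0⟩ : ∃ e0, e0 = min ε 1 := ⟨_, rfl⟩
  have he00 : 0 < e0 := by rw [he0]; positivity
  refine ⟨K * (1 + 2 / e0), by positivity, ?_⟩
  rintro γ - lam hl ⟨v0, hv0, hv⟩ x0 ⟨hx, hxx, -⟩
  change act γ v0 = _ at hv
  change act γ x0 = _ at hx
  obtain ⟨v, v', vl, vl', v2, v2', vv', vx, vx', gv, gv', α, δ, hα, hexp⟩ :=
    axis h hl hv0 hv hx hxx
  have lne : lam ≠ 0 := by linarith
  have iv : ∀ {a : Fin 3 → ℝ} {c : ℝ}, c ≠ 0 → act γ a = c • a → act γ⁻¹ a = c⁻¹ • a := by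
    intro a c hc ha
    have := act_inv_act γ a
    rw [ha, act_smul] at this
    rwa [eq_inv_smul_iff₀ hc]
  have Cv : InC Γ₀ v := InC_eig hl hα hexp gv gv' hx
  have Cv' : InC Γ₀ v' := by
    refine InC_eig (g := γ⁻¹) (v := v') (v' := v) (x0 := x0) (α := 1) (β := α) (δ := δ) hl
      one_pos ?_ ?_ (iv lne gv) ?_
    · rw [add_comm ((1:ℝ) • v')]; exact hexp
    · have := iv (inv_ne_zero lne) gv'
      rwa [inv_inv] at this
    · have := iv one_ne_zero (show act γ x0 = (1:ℝ) • x0 by rw [hx, one_smul])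
      rwa [inv_one, one_smul] at this
  obtain ⟨l, hll⟩ : ∃ l, l = Real.log lam := ⟨_, rfl⟩
  have l0 : 0 < l := by rw [hll]; exact Real.log_pos hl
  have hel : Real.exp l = lam := by rw [hll, Real.exp_log (by linarith)]
  have P1 : ∀ s, Bform (axp v v' s) (axp v v' s) = -1 := fun s => by
    rw [axp_B vl vl' vv', sub_self, Real.cosh_zero]
  have P2 : ∀ s, 0 < axp v v' s 2 := fun s => by
    simp only [axp, Pi.add_apply, Pi.smul_apply, smul_eq_mul]; positivity
  have PC : ∀ s, InC Γ₀ (axp v v' s) := fun s =>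
    InC_add (InC_smul Cv (Real.exp_pos _).le) (InC_smul Cv' (Real.exp_pos _).le)
  have Px : ∀ s, Bform x0 (axp v v' s) = 0 := fun s => by
    rw [B_comm, axp, B_add_l, B_smul_l, B_smul_l, vx, vx']; ring
  have Pg : ∀ s, act γ (axp v v' s) = axp v v' (s + l) := fun s => by
    rw [axp, act_add, act_smul, act_smul, gv, gv', axp, smul_smul, smul_smul, neg_add,
      Real.exp_add, Real.exp_add, hel, Real.exp_neg l, hel]
  have PP : ∀ s t, |s - t| ≤ 1 → - Bform (axp v v' s) (axp v v' t) ≤ 2 := fun s t hst => by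
    rw [axp_B vl vl' vv', neg_neg]
    refine le_trans (Real.cosh_le_cosh.2 ?_) cosh_one_le
    rwa [abs_one]
  choose G hG using fun s => hB (axp v v' s) (P1 s) (P2 s) (PC s)
  have hγG : - Bform (axp v v' l) (orb (γ * G 0)) ≤ R := by
    have e : axp v v' l = act γ (axp v v' 0) := by rw [Pg, zero_add]
    rw [e, orb_mul, B_act h]; exact hG 0
  -- lower bound on the length
  have hlow : e0 ≤ l := by
    rcases le_or_gt l 1 with h1 | h1
    · have := near_step h hR (P1 0) (P2 0) (P1 l) (P2 l)
        (PP 0 l (by rw [zero_sub, abs_neg, abs_of_pos l0]; exact h1)) (hG 0) hγG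
      have h2 := hεl _ this lam hl (act (G 0)⁻¹ v) ?_ ?_
      · rw [he0, hll]; exact (min_le_left _ _).trans h2
      · intro h3
        have := act_act_inv (G 0) v
        rw [h3] at this
        have h4 := congrFun this 2
        simp [act] at h4
        linarith
      · rw [act_mul, act_mul, act_act_inv, gv, act_smul]
    · rw [he0]; exact (min_le_right _ _).trans h1.le
  -- the chain
  set n := ⌈l⌉₊ with hn
  have n0 : 0 < n := Nat.ceil_pos.2 l0
  have n0' : (0:ℝ) < n := by exact_mod_cast n0
  have nl : l ≤ n := Nat.le_ceil l
  have nu : (n:ℝ) < l + 1 := Nat.ceil_lt_add_one l0.le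
  have hstep : ∀ s t (g g' : Γ₀), |s - t| ≤ 1 → - Bform (axp v v' s) (orb g) ≤ R →
      - Bform (axp v v' t) (orb g') ≤ R → |Bform (u g') x0 - Bform (u g) x0| ≤ K := by
    intro s t g g' hst hg hg'
    have := cocycle_step h hu hR hMu' (P1 s) (P2 s) (P1 t) (P2 t) (PP s t hst) hxx (Px s) hg hg'
    linarith
  have htel := telescope (c := fun k : ℕ => Bform (u (G (k * (l / n)))) x0) (K := K) n (by
    intro k
    refine hstep _ _ _ _ ?_ (hG _) (hG _)
    push_cast
    have e : (k:ℝ) * (l / n) - (k + 1) * (l / n) = -(l / n) := by ring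
    rw [e, abs_neg, abs_of_pos (by positivity), div_le_one n0']
    exact nl)
  have e1 : (n:ℝ) * (l / n) = l := by field_simp
  simp only [e1, Nat.cast_zero, zero_mul] at htel
  have hlast := hstep l l (G l) (γ * G 0) (by simp) (hG l) hγG
  have ecoc : Bform (u (γ * G 0)) x0 = Bform (u γ) x0 + Bform (u (G 0)) x0 := by
    have e2 : u (γ * G 0) = u γ + act γ (u (G 0)) := hu γ (G 0)
    have e3 := B_act h γ (u (G 0)) x0
    rw [hx] at e3
    rw [e2, B_add_l, e3]
  have hfin : |Bform (u γ) x0| ≤ (n + 1) * K := by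
    have e4 : Bform (u γ) x0 = (Bform (u (γ * G 0)) x0 - Bform (u (G l)) x0) +
      (Bform (u (G l)) x0 - Bform (u (G 0)) x0) := by rw [ecoc]; ring
    rw [e4]
    refine (abs_add_le _ _).trans ?_
    linarith
  have h2l : 2 ≤ 2 / e0 * l := by
    rw [div_mul_eq_mul_div, le_div_iff₀ he00]; linarith
  rw [← hll]
  calc |Bform (u γ) x0| ≤ (n + 1) * K := hfin
    _ ≤ (l + 2 / e0 * l) * K := by
        apply mul_le_mul_of_nonneg_right _ hK0.le
        linarith
    _ = _ := by ring

end
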